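/- Let F : SO(N) → ℝ be Lipschitz with constant ‖F‖_L with respect to the Euclidean (Hilbert–Schmidt) distance on matrices. Then for the Haar probability measure M_N on SO(N) and every ε > 0, M_N(|F(U) − ∫F dM_N| ≥ ε) ≤ exp(−c N ‖F‖_L^{-2} ε²) for a universal constant c > 0 independent of N. -/

import Mathlib

open MeasureTheory Set

instance matrixMeasurableSpace (N : ℕ) : MeasurableSpace (Matrix (Fin N) (Fin N) ℝ) :=
  borel _

instance matrixBorelSpace (N : ℕ) : BorelSpace (Matrix (Fin N) (Fin N) ℝ) := ⟨rfl⟩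

namespace SOConcentration

open Matrix

variable {N : ℕ}

/-! ### The Hilbert–Schmidt inner product -/

/-- The Hilbert–Schmidt inner product of real matrices. -/
def ip (A B : Matrix (Fin N) (Fin N) ℝ) : ℝ := ∑ i, ∑ j, A i j * B i j

/-- The Hilbert–Schmidt norm of a real matrix. -/
noncomputable def hs (A : Matrix (Fin N) (Fin N) ℝ) : ℝ := Real.sqrt (ip A A)

lemma ip_eq_trace (A B : Matrix (Fin N) (Fin N) ℝ) : ip A B = (Aᵀ * B).trace := by
  simp only [ip, Matrix.trace, Matrix.diag, Matrix.mul_apply, Matrix.transpose_apply]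
  exact Finset.sum_comm

lemma ip_comm (A B : Matrix (Fin N) (Fin N) ℝ) : ip A B = ip B A := by
  simp only [ip, mul_comm]

lemma ip_add_right (A B C : Matrix (Fin N) (Fin N) ℝ) : ip A (B + C) = ip A B + ip A C := by
  simp only [ip, Matrix.add_apply, mul_add, Finset.sum_add_distrib]

lemma ip_smul_right (c : ℝ) (A B : Matrix (Fin N) (Fin N) ℝ) : ip A (c • B) = c * ip A B := by
  simp only [ip, Matrix.smul_apply, smul_eq_mul, Finset.mul_sum]
  exact Finset.sum_congr rfl fun i _ => Finset.sum_congr rfl fun j _ => by ring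

lemma ip_sub_right (A B C : Matrix (Fin N) (Fin N) ℝ) : ip A (B - C) = ip A B - ip A C := by
  simp only [ip, Matrix.sub_apply, mul_sub, Finset.sum_sub_distrib]

lemma ip_add_left (A B C : Matrix (Fin N) (Fin N) ℝ) : ip (A + B) C = ip A C + ip B C := by
  rw [ip_comm, ip_add_right, ip_comm C, ip_comm C]

lemma ip_sub_left (A B C : Matrix (Fin N) (Fin N) ℝ) : ip (A - B) C = ip A C - ip B C := by
  rw [ip_comm, ip_sub_right, ip_comm C, ip_comm C]

lemma ip_smul_left (c : ℝ) (A B : Matrix (Fin N) (Fin N) ℝ) : ip (c • A) B = c * ip A B := by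
  rw [ip_comm, ip_smul_right, ip_comm]

lemma ip_neg_left (A B : Matrix (Fin N) (Fin N) ℝ) : ip (-A) B = -ip A B := by
  simp [ip]

lemma ip_neg_right (A B : Matrix (Fin N) (Fin N) ℝ) : ip A (-B) = -ip A B := by
  simp [ip]

lemma ip_sum_right {ι : Type*} (s : Finset ι) (A : Matrix (Fin N) (Fin N) ℝ)
    (f : ι → Matrix (Fin N) (Fin N) ℝ) : ip A (∑ k ∈ s, f k) = ∑ k ∈ s, ip A (f k) := by
  classical
  induction s using Finset.induction_on with
  | empty => simp [ip]
  | insert a s ha ih => rw [Finset.sum_insert ha, Finset.sum_insert ha, ip_add_right, ih]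

lemma ip_mul_left (A B Q : Matrix (Fin N) (Fin N) ℝ) : ip A (Q * B) = ip (Qᵀ * A) B := by
  rw [ip_eq_trace, ip_eq_trace, Matrix.transpose_mul, Matrix.transpose_transpose, Matrix.mul_assoc]

lemma ip_mul_right (A B Q : Matrix (Fin N) (Fin N) ℝ) : ip A (B * Q) = ip (A * Qᵀ) B := by
  rw [ip_eq_trace, ip_eq_trace, Matrix.transpose_mul, Matrix.transpose_transpose,
    ← Matrix.mul_assoc, Matrix.trace_mul_comm, ← Matrix.mul_assoc]

lemma ip_transpose (A B : Matrix (Fin N) (Fin N) ℝ) : ip Aᵀ Bᵀ = ip A B := by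
  simp only [ip, Matrix.transpose_apply]
  exact Finset.sum_comm

lemma ip_self_nonneg (A : Matrix (Fin N) (Fin N) ℝ) : 0 ≤ ip A A :=
  Finset.sum_nonneg fun _ _ => Finset.sum_nonneg fun _ _ => mul_self_nonneg _

lemma hs_nonneg (A : Matrix (Fin N) (Fin N) ℝ) : 0 ≤ hs A := Real.sqrt_nonneg _

lemma hs_sq (A : Matrix (Fin N) (Fin N) ℝ) : hs A ^ 2 = ip A A := Real.sq_sqrt (ip_self_nonneg A)

lemma abs_ip_le (A B : Matrix (Fin N) (Fin N) ℝ) : |ip A B| ≤ hs A * hs B := by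
  have h := Finset.sum_mul_sq_le_sq_mul_sq (Finset.univ : Finset (Fin N × Fin N))
    (fun p => A p.1 p.2) (fun p => B p.1 p.2)
  simp only [Fintype.sum_prod_type, pow_two] at h
  apply abs_le_of_sq_le_sq _ (mul_nonneg (hs_nonneg A) (hs_nonneg B))
  rw [mul_pow, hs_sq, hs_sq, pow_two]
  exact h

lemma hs_add_le (A B : Matrix (Fin N) (Fin N) ℝ) : hs (A + B) ≤ hs A + hs B := by
  refine (le_abs_self _).trans (abs_le_of_sq_le_sq ?_ (add_nonneg (hs_nonneg A) (hs_nonneg B)))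
  rw [hs_sq, ip_add_right, ip_add_left, ip_add_left, ip_comm B A]
  nlinarith [hs_sq A, hs_sq B, le_abs_self (ip A B), abs_ip_le A B]

lemma hs_smul (c : ℝ) (A : Matrix (Fin N) (Fin N) ℝ) : hs (c • A) = |c| * hs A := by
  rw [hs, ip_smul_right, ip_smul_left, ← mul_assoc, ← pow_two, Real.sqrt_mul (sq_nonneg _),
    Real.sqrt_sq_eq_abs, hs]

lemma hs_neg (A : Matrix (Fin N) (Fin N) ℝ) : hs (-A) = hs A := by
  rw [← neg_one_smul ℝ A, hs_smul]; simp

lemma hs_sub_le (A B : Matrix (Fin N) (Fin N) ℝ) : hs (A - B) ≤ hs A + hs B := by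
  rw [sub_eq_add_neg, ← hs_neg B]; exact hs_add_le _ _

lemma hs_mul_le (A B : Matrix (Fin N) (Fin N) ℝ) : hs (A * B) ≤ hs A * hs B := by
  refine (le_abs_self _).trans (abs_le_of_sq_le_sq ?_ (mul_nonneg (hs_nonneg A) (hs_nonneg B)))
  rw [mul_pow, hs_sq, hs_sq, hs_sq]
  have h1 : ip A A * ip B B = ∑ i, ∑ j, (∑ k, A i k ^ 2) * (∑ k, B k j ^ 2) := by
    rw [ip_comm B B, ← ip_transpose B B, ip, ip, Finset.sum_mul_sum]
    simp only [Matrix.transpose_apply, pow_two]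
  rw [h1, ip]
  refine Finset.sum_le_sum fun i _ => Finset.sum_le_sum fun j _ => ?_
  rw [← pow_two, Matrix.mul_apply]
  exact Finset.sum_mul_sq_le_sq_mul_sq _ _ _

lemma ip_orth_mul (A B Q : Matrix (Fin N) (Fin N) ℝ) (hQ : Qᵀ * Q = 1) :
    ip (Q * A) (Q * B) = ip A B := by
  rw [ip_mul_left, ← Matrix.mul_assoc, hQ, Matrix.one_mul]

lemma ip_mul_orth (A B Q : Matrix (Fin N) (Fin N) ℝ) (hQ : Q * Qᵀ = 1) :
    ip (A * Q) (B * Q) = ip A B := by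
  rw [ip_mul_right, Matrix.mul_assoc, hQ, Matrix.mul_one]

lemma hs_orth_mul (A Q : Matrix (Fin N) (Fin N) ℝ) (hQ : Qᵀ * Q = 1) : hs (Q * A) = hs A := by
  rw [hs, ip_orth_mul _ _ _ hQ, hs]

lemma hs_mul_orth (A Q : Matrix (Fin N) (Fin N) ℝ) (hQ : Q * Qᵀ = 1) : hs (A * Q) = hs A := by
  rw [hs, ip_mul_orth _ _ _ hQ, hs]

@[fun_prop]
lemma continuous_ip {X : Type*} [TopologicalSpace X] {f g : X → Matrix (Fin N) (Fin N) ℝ}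
    (hf : Continuous f) (hg : Continuous g) : Continuous fun x => ip (f x) (g x) := by
  unfold ip
  exact continuous_finsetSum _ fun i _ => continuous_finsetSum _ fun j _ =>
    (hf.matrix_elem i j).mul (hg.matrix_elem i j)

@[fun_prop]
lemma continuous_hs {X : Type*} [TopologicalSpace X] {f : X → Matrix (Fin N) (Fin N) ℝ}
    (hf : Continuous f) : Continuous fun x => hs (f x) := by
  unfold hs
  exact Real.continuous_sqrt.comp (continuous_ip hf hf)

/-! ### The compact group `SO(N)` -/

instance (N : ℕ) : SecondCountableTopology (Matrix (Fin N) (Fin N) ℝ) :=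
  inferInstanceAs (SecondCountableTopology (Fin N → Fin N → ℝ))

instance (N : ℕ) : LocallyCompactSpace (Matrix (Fin N) (Fin N) ℝ) :=
  inferInstanceAs (LocallyCompactSpace (Fin N → Fin N → ℝ))

instance (N : ℕ) : T2Space (Matrix (Fin N) (Fin N) ℝ) :=
  inferInstanceAs (T2Space (Fin N → Fin N → ℝ))

/-- The special orthogonal group as a type. -/
abbrev SO (N : ℕ) : Type := Matrix.specialOrthogonalGroup (Fin N) ℝ

instance (N : ℕ) : BorelSpace (SO N) := Subtype.borelSpace _

instance (N : ℕ) : SecondCountableTopology (SO N) :=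
  TopologicalSpace.Subtype.secondCountableTopology _

lemma mem_SO {U : Matrix (Fin N) (Fin N) ℝ} :
    U ∈ Matrix.specialOrthogonalGroup (Fin N) ℝ ↔ U * Uᵀ = 1 ∧ U.det = 1 := by
  rw [Matrix.mem_specialOrthogonalGroup_iff, Matrix.mem_orthogonalGroup_iff]

lemma coe_inv_SO (U : SO N) : ((U⁻¹ : SO N) : Matrix (Fin N) (Fin N) ℝ) =
    (U : Matrix (Fin N) (Fin N) ℝ)ᵀ := rfl

lemma SO_mul_transpose (U : SO N) :
    (U : Matrix (Fin N) (Fin N) ℝ) * (U : Matrix (Fin N) (Fin N) ℝ)ᵀ = 1 :=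
  (mem_SO.1 U.2).1

lemma SO_transpose_mul (U : SO N) :
    (U : Matrix (Fin N) (Fin N) ℝ)ᵀ * (U : Matrix (Fin N) (Fin N) ℝ) = 1 :=
  mul_eq_one_comm.1 (SO_mul_transpose U)

instance (N : ℕ) : IsTopologicalGroup (SO N) where
  continuous_inv := by
    refine Continuous.subtype_mk (f := fun U : SO N => (U : Matrix (Fin N) (Fin N) ℝ)ᵀ) ?_ _
    exact continuous_subtype_val.matrix_transpose

lemma ip_one_one : ip (1 : Matrix (Fin N) (Fin N) ℝ) 1 = N := by
  rw [ip_eq_trace]; simp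

lemma hs_SO (U : SO N) : hs (U : Matrix (Fin N) (Fin N) ℝ) = Real.sqrt N := by
  rw [← Matrix.mul_one (U : Matrix (Fin N) (Fin N) ℝ), hs_orth_mul _ _ (SO_transpose_mul U), hs,
    ip_one_one]

lemma isCompact_SO (N : ℕ) :
    IsCompact (Matrix.specialOrthogonalGroup (Fin N) ℝ : Set (Matrix (Fin N) (Fin N) ℝ)) := by
  have hK : IsCompact (Set.pi univ fun _ : Fin N => Set.pi univ fun _ : Fin N =>
      Icc (-1 : ℝ) 1) := isCompact_univ_pi fun _ => isCompact_univ_pi fun _ => isCompact_Icc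
  have hK' : IsCompact {U : Matrix (Fin N) (Fin N) ℝ | ∀ i j, U i j ∈ Icc (-1 : ℝ) 1} := by
    have h : {U : Matrix (Fin N) (Fin N) ℝ | ∀ i j, U i j ∈ Icc (-1 : ℝ) 1} =
        Set.pi univ fun _ : Fin N => Set.pi univ fun _ : Fin N => Icc (-1 : ℝ) 1 :=
      Set.ext fun U => ⟨fun h i _ j _ => h i j, fun h i j => h i trivial j trivial⟩
    rw [h]
    exact hK
  refine hK'.of_isClosed_subset ?_ ?_
  · have : (Matrix.specialOrthogonalGroup (Fin N) ℝ : Set (Matrix (Fin N) (Fin N) ℝ))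
        = {U | U * Uᵀ = 1} ∩ {U | U.det = 1} := by
      refine Set.ext fun U => ?_
      exact mem_SO
    rw [this]
    exact (isClosed_eq (by fun_prop) continuous_const).inter
      (isClosed_eq (continuous_id.matrix_det) continuous_const)
  · intro U hU i j
    have h : ∑ k, U i k ^ 2 = 1 := by
      have := congrFun (congrFun (mem_SO.1 hU).1 i) i
      simpa [Matrix.mul_apply, pow_two] using this
    have : U i j ^ 2 ≤ 1 := h ▸ Finset.single_le_sum (f := fun k => U i k ^ 2)
      (fun k _ => sq_nonneg _) (Finset.mem_univ j)
    exact abs_le.1 (by simpa using sq_le_one_iff_abs_le_one _ |>.1 this)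

instance (N : ℕ) : CompactSpace (SO N) := isCompact_iff_compactSpace.1 (isCompact_SO N)

@[fun_prop]
lemma continuous_coe_SO {X : Type*} [TopologicalSpace X] {f : X → SO N} (hf : Continuous f) :
    Continuous fun x => (f x : Matrix (Fin N) (Fin N) ℝ) := continuous_subtype_val.comp hf

lemma integrable_SO {E : Type*} [NormedAddCommGroup E] (μ : Measure (SO N)) [IsFiniteMeasure μ]
    {f : SO N → E} (hf : Continuous f) : Integrable f μ :=
  hf.integrable_of_hasCompactSupport (HasCompactSupport.of_compactSpace f)

lemma integrable_SO_prod (μ ν : Measure (SO N)) [IsFiniteMeasure μ] [IsFiniteMeasure ν]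
    {f : SO N × SO N → ℝ} (hf : Continuous f) : Integrable f (μ.prod ν) :=
  hf.integrable_of_hasCompactSupport (HasCompactSupport.of_compactSpace f)

lemma continuous_integral_SO {X : Type*} [TopologicalSpace X] [FirstCountableTopology X]
    [LocallyCompactSpace X] (μ : Measure (SO N)) [IsFiniteMeasure μ]
    {f : X → SO N → ℝ} (hf : Continuous f.uncurry) : Continuous fun x => ∫ y, f x y ∂μ := by
  simpa using continuous_parametric_integral_of_continuous (μ := μ) hf isCompact_univ

instance (μ : Measure (SO N)) [IsProbabilityMeasure μ] [μ.IsMulLeftInvariant] :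
    μ.IsHaarMeasure :=
  Measure.isHaarMeasure_of_isCompact_nonempty_interior μ univ isCompact_univ (by simp) (by simp)
    (by simp)

instance (μ : Measure (SO N)) [IsProbabilityMeasure μ] [μ.IsMulLeftInvariant] :
    μ.IsMulRightInvariant where
  map_mul_right_eq_self g := by
    have : IsProbabilityMeasure (μ.map (· * g)) :=
      Measure.isProbabilityMeasure_map (continuous_mul_const g).aemeasurable
    exact Measure.isHaarMeasure_eq_of_isProbabilityMeasure _ _

/-! ### Plane rotations -/

/-- The generator of rotations in the coordinate plane spanned by `e_i` and `e_j`. -/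
def gen (i j : Fin N) : Matrix (Fin N) (Fin N) ℝ := Matrix.single i j 1 - Matrix.single j i 1

lemma gen_swap (i j : Fin N) : gen j i = -gen i j := by simp [gen]

lemma gen_transpose (i j : Fin N) : (gen i j)ᵀ = -gen i j := by
  simp [gen, Matrix.transpose_single]

lemma ip_single (D : Matrix (Fin N) (Fin N) ℝ) (i j : Fin N) :
    ip D (Matrix.single i j 1) = D i j := by
  simp [ip, Matrix.single_apply, ite_and]

lemma ip_gen (D : Matrix (Fin N) (Fin N) ℝ) (i j : Fin N) : ip D (gen i j) = D i j - D j i := by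
  rw [gen, ip_sub_right, ip_single, ip_single]

lemma ip_gen_self_le (i j : Fin N) : ip (gen i j) (gen i j) ≤ 2 := by
  rw [ip_gen]
  by_cases h : i = j
  · subst h; simp
  · simp [gen, h, Ne.symm h]; norm_num

lemma hs_gen_le (i j : Fin N) : hs (gen i j) ≤ 2 := by
  rw [hs]
  exact Real.sqrt_le_iff.2 ⟨by norm_num, (ip_gen_self_le i j).trans (by norm_num)⟩

lemma gen_cube (i j : Fin N) : gen i j * gen i j * gen i j = -gen i j := by
  by_cases h : i = j
  · subst h; simp [gen]
  · simp [gen, sub_mul, mul_sub, h, Ne.symm h, neg_add_eq_sub]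

/-- The map `1 + b E + (1 - a) E²`, a rotation when `a ^ 2 + b ^ 2 = 1`. -/
def rot (i j : Fin N) (a b : ℝ) : Matrix (Fin N) (Fin N) ℝ :=
  1 + b • gen i j + (1 - a) • (gen i j * gen i j)

lemma rot_mul (i j : Fin N) (a b a' b' : ℝ) :
    rot i j a b * rot i j a' b' = rot i j (a * a' - b * b') (a * b' + b * a') := by
  have h3 := gen_cube i j
  have h4 : gen i j * gen i j * (gen i j * gen i j) = -(gen i j * gen i j) := by
    rw [← mul_assoc, h3, neg_mul]
  have h3' : gen i j * (gen i j * gen i j) = -gen i j := by rw [← mul_assoc, h3]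
  simp only [rot, add_mul, mul_add, one_mul, mul_one, smul_mul_assoc, mul_smul_comm, h3, h4, h3']
  module

lemma rot_one_zero (i j : Fin N) : rot i j 1 0 = 1 := by simp [rot]

lemma rot_transpose (i j : Fin N) (a b : ℝ) : (rot i j a b)ᵀ = rot i j a (-b) := by
  simp [rot, Matrix.transpose_add, Matrix.transpose_mul, gen_transpose]

lemma rot_swap (i j : Fin N) (a b : ℝ) : rot j i a b = rot i j a (-b) := by
  simp [rot, gen_swap i j]

lemma rot_mul_transpose (i j : Fin N) {a b : ℝ} (h : a ^ 2 + b ^ 2 = 1) :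
    rot i j a b * (rot i j a b)ᵀ = 1 := by
  rw [rot_transpose, rot_mul, ← rot_one_zero i j]
  congr 1
  · linarith
  · ring

lemma exists_half_angle {a b : ℝ} (h : a ^ 2 + b ^ 2 = 1) :
    ∃ c d : ℝ, c ^ 2 + d ^ 2 = 1 ∧ c * c - d * d = a ∧ c * d + d * c = b := by
  by_cases ha : a = -1
  · exact ⟨0, 1, by norm_num, by rw [ha]; norm_num, by
      have : b ^ 2 = 0 := by rw [ha] at h; linarith
      have := pow_eq_zero_iff (two_ne_zero) |>.1 this
      rw [this]; norm_num⟩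
  · have h1 : 0 < (1 + a) / 2 := by
      have : -1 ≤ a := by nlinarith
      have : -1 < a := lt_of_le_of_ne this (Ne.symm ha)
      linarith
    have h2 := Real.sq_sqrt h1.le
    have h3 := Real.sqrt_pos.2 h1
    set c := Real.sqrt ((1 + a) / 2)
    have h4 : (b / (2 * c)) ^ 2 = (1 - a) / 2 := by
      rw [div_pow, mul_pow, h2, div_eq_div_iff (by positivity) (by norm_num)]
      nlinarith
    refine ⟨c, b / (2 * c), by rw [h4, h2]; ring, ?_, by field_simp; ring⟩
    rw [← pow_two, ← pow_two, h4, h2]; ring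

lemma rot_mem_SO (i j : Fin N) {a b : ℝ} (h : a ^ 2 + b ^ 2 = 1) :
    rot i j a b ∈ Matrix.specialOrthogonalGroup (Fin N) ℝ := by
  refine mem_SO.2 ⟨rot_mul_transpose i j h, ?_⟩
  obtain ⟨c, d, hcd, h1, h2⟩ := exists_half_angle h
  rw [← h1, ← h2, ← rot_mul, Matrix.det_mul]
  have := congrArg Matrix.det (rot_mul_transpose i j hcd)
  rwa [Matrix.det_mul, Matrix.det_transpose, Matrix.det_one] at this

/-! ### Skew-symmetric matrices -/

lemma skew_eq_sum_gen {A : Matrix (Fin N) (Fin N) ℝ} (hA : Aᵀ = -A) :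
    A = ∑ i, ∑ j, (A i j / 2) • gen i j := by
  have h : ∑ i, ∑ j, (A i j / 2) • gen i j = (1 / 2 : ℝ) • A - (1 / 2 : ℝ) • Aᵀ := by
    conv_rhs => rw [Matrix.matrix_eq_sum_single A]
    simp only [gen, smul_sub, Finset.sum_sub_distrib, Matrix.transpose_sum, Finset.smul_sum,
      Matrix.transpose_single, Matrix.smul_single, smul_eq_mul, mul_one]
    congr 1 <;> simp only [div_eq_inv_mul, mul_one]
  rw [h, hA]
  module

lemma sum_ip_gen_sq_le {D : Matrix (Fin N) (Fin N) ℝ} {l : ℝ}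
    (hD : ∀ A : Matrix (Fin N) (Fin N) ℝ, Aᵀ = -A → |ip D A| ≤ l * hs A) :
    ∑ i, ∑ j, ip D (gen i j) ^ 2 ≤ 4 * l ^ 2 := by
  have hA : (D - Dᵀ)ᵀ = -(D - Dᵀ) := by simp
  have h1 : ∑ i, ∑ j, ip D (gen i j) ^ 2 = ip (D - Dᵀ) (D - Dᵀ) := by
    simp only [ip_gen]
    simp only [ip, Matrix.sub_apply, Matrix.transpose_apply, pow_two]
  have h2 : ip D (D - Dᵀ) = ip (D - Dᵀ) (D - Dᵀ) / 2 := by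
    have : ip Dᵀ (D - Dᵀ) = -ip D (D - Dᵀ) := by
      rw [← ip_transpose Dᵀ, hA, Matrix.transpose_transpose, ip_neg_right]
    rw [ip_sub_left, this]; ring
  have h3 := hD _ hA
  rw [h2] at h3
  rw [h1]
  have h4 := hs_sq (D - Dᵀ)
  have h5 := le_abs_self (ip (D - Dᵀ) (D - Dᵀ) / 2)
  have h6 := hs_nonneg (D - Dᵀ)
  rw [← h4] at h3 h5 ⊢
  nlinarith [sq_nonneg (hs (D - Dᵀ) - 2 * l)]

lemma gen_mul_gen (i j : Fin N) : gen i j * gen i j =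
    Matrix.single i j 1 * Matrix.single i j 1 - Matrix.single i i 1 - Matrix.single j j 1 +
      Matrix.single j i 1 * Matrix.single j i 1 := by
  simp only [gen, sub_mul, mul_sub, Matrix.single_mul_single_same, mul_one]
  abel

lemma sum_single_diag : ∑ i : Fin N, Matrix.single i i (1 : ℝ) = 1 := by
  refine Matrix.ext fun a b => ?_
  simp [Matrix.sum_apply, Matrix.single_apply, Matrix.one_apply, ite_and]

lemma sum_gen_mul_gen : ∑ i : Fin N, ∑ j, gen i j * gen i j =
    (-2 * ((N : ℝ) - 1)) • (1 : Matrix (Fin N) (Fin N) ℝ) := by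
  have h : ∀ i j : Fin N, Matrix.single i j (1 : ℝ) * Matrix.single i j (1 : ℝ) =
      if i = j then Matrix.single i i 1 else 0 := fun i j => by
    by_cases hij : i = j
    · subst hij; simp
    · simp [hij, Ne.symm hij]
  simp only [gen_mul_gen, h, Finset.sum_add_distrib, Finset.sum_sub_distrib, Finset.sum_ite_eq,
    Finset.mem_univ, if_true, sum_single_diag, Finset.sum_const, Finset.card_univ,
    Fintype.card_fin, ← Finset.smul_sum, Finset.sum_ite_eq']
  module

lemma single_mul_mul_single (A : Matrix (Fin N) (Fin N) ℝ) (i j k l : Fin N) :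
    Matrix.single i j 1 * A * Matrix.single k l 1 = Matrix.single i l (A j k) := by
  simp

lemma sum_gen_mul_mul_gen {A : Matrix (Fin N) (Fin N) ℝ} (hA : Aᵀ = -A) :
    ∑ i : Fin N, ∑ j, gen i j * A * gen i j = (-2 : ℝ) • A := by
  have hd : ∀ j, A j j = 0 := fun j => by
    have := congrFun (congrFun hA j) j
    simp only [Matrix.transpose_apply, Matrix.neg_apply] at this
    linarith
  have h2 : ∑ i, ∑ j, Matrix.single i j (A j i) = Aᵀ := by
    conv_rhs => rw [Matrix.matrix_eq_sum_single Aᵀ]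
    simp only [Matrix.transpose_apply]
  have h1 : ∑ i, ∑ j, Matrix.single j i (A i j) = Aᵀ := by
    rw [Finset.sum_comm, h2]
  simp only [gen, sub_mul, mul_sub, single_mul_mul_single, Finset.sum_sub_distrib, h1, h2, hd,
    Matrix.single_zero, Finset.sum_const_zero, hA]
  module

/-- The Casimir element acts on `so(N)` by the scalar `4 (N - 2)`. -/
lemma sum_commutator_gen {A : Matrix (Fin N) (Fin N) ℝ} (hA : Aᵀ = -A) :
    ∑ i : Fin N, ∑ j, ip (A * gen i j - gen i j * A) (A * gen i j - gen i j * A) =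
      4 * ((N : ℝ) - 2) * ip A A := by
  have h : ∀ i j : Fin N, ip (A * gen i j - gen i j * A) (A * gen i j - gen i j * A) =
      -ip A (A * (gen i j * gen i j)) - ip A (gen i j * gen i j * A) +
        2 * ip A (gen i j * A * gen i j) := fun i j => by
    have e1 : ip (A * gen i j) (A * gen i j) = -ip A (A * (gen i j * gen i j)) := by
      rw [← mul_assoc, ip_mul_right A, gen_transpose, mul_neg, ip_neg_left, neg_neg]
    have e2 : ip (gen i j * A) (gen i j * A) = -ip A (gen i j * gen i j * A) := by
      rw [mul_assoc (gen i j) (gen i j), ip_mul_left A, gen_transpose, neg_mul, ip_neg_left,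
          neg_neg]
    have e3 : ip (A * gen i j) (gen i j * A) = -ip A (gen i j * A * gen i j) := by
      rw [ip_mul_right A, gen_transpose, mul_neg, ip_neg_left, neg_neg]
    rw [ip_sub_right, ip_sub_left, ip_sub_left, ip_comm (gen i j * A) (A * gen i j), e1, e2, e3]
    ring
  simp only [h, Finset.sum_add_distrib, Finset.sum_sub_distrib, Finset.sum_neg_distrib,
    ← Finset.mul_sum, ← ip_sum_right, ← Finset.sum_mul]
  simp only [sum_gen_mul_gen, sum_gen_mul_mul_gen hA]
  simp only [mul_smul_comm, smul_mul_assoc, mul_one, one_mul, ip_smul_right]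
  ring

lemma sum_commutator_rot_ge {A : Matrix (Fin N) (Fin N) ℝ} (hA : Aᵀ = -A) (a b : ℝ) :
    b ^ 2 * (4 * ((N : ℝ) - 2)) * ip A A ≤
      ∑ i : Fin N, ∑ j, ip (A * rot i j a b - rot i j a b * A)
        (A * rot i j a b - rot i j a b * A) := by
  set C : Fin N → Fin N → Matrix (Fin N) (Fin N) ℝ := fun i j => A * gen i j - gen i j * A with hC
  set B : Fin N → Fin N → Matrix (Fin N) (Fin N) ℝ := fun i j =>
    A * (gen i j * gen i j) - gen i j * gen i j * A with hB
  have h : ∀ i j : Fin N, A * rot i j a b - rot i j a b * A = b • C i j + (1 - a) • B i j := by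
    intro i j
    simp only [rot, hC, hB, mul_add, add_mul, mul_one, one_mul, mul_smul_comm, smul_mul_assoc]
    module
  have hcross : ∑ i : Fin N, ∑ j, ip (C i j) (B i j) = 0 := by
    have h1 : ∑ i : Fin N, ∑ j, ip (C i j) (B i j) = ∑ i : Fin N, ∑ j, -ip (C i j) (B i j) := by
      rw [Finset.sum_comm]
      refine Finset.sum_congr rfl fun i _ => Finset.sum_congr rfl fun j _ => ?_
      have e1 : C j i = (-1 : ℝ) • C i j := by
        simp only [hC, gen_swap i j, mul_neg, neg_mul]; module
      have e2 : B j i = B i j := by simp only [hB, gen_swap i j, mul_neg, neg_mul, neg_neg]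
      rw [e1, e2, ip_smul_left]; ring
    simp only [Finset.sum_neg_distrib] at h1
    linarith
  have h2 : ∀ i j, ip (A * rot i j a b - rot i j a b * A) (A * rot i j a b - rot i j a b * A) =
      b ^ 2 * ip (C i j) (C i j) + (1 - a) ^ 2 * ip (B i j) (B i j) +
        2 * b * (1 - a) * ip (C i j) (B i j) := fun i j => by
    rw [h, ip_add_right, ip_add_left, ip_add_left]
    simp only [ip_smul_left, ip_smul_right]
    rw [ip_comm (B i j) (C i j)]
    ring
  simp only [h2, Finset.sum_add_distrib, ← Finset.mul_sum, hcross, mul_zero, add_zero]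
  rw [hC, sum_commutator_gen hA, mul_assoc]
  have : 0 ≤ (1 - a) ^ 2 * ∑ i, ∑ j, ip (B i j) (B i j) :=
    mul_nonneg (sq_nonneg _) (Finset.sum_nonneg fun _ _ => Finset.sum_nonneg fun _ _ =>
      ip_self_nonneg _)
  linarith

/-! ### A conjugation-invariant random walk with small steps -/

/-- The skew-symmetric part of a matrix. -/
noncomputable def skewPart (M : Matrix (Fin N) (Fin N) ℝ) : Matrix (Fin N) (Fin N) ℝ :=
  (1 / 2 : ℝ) • (M - Mᵀ)

@[fun_prop]
lemma continuous_skewPart {X : Type*} [TopologicalSpace X] {f : X → Matrix (Fin N) (Fin N) ℝ}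
    (hf : Continuous f) : Continuous fun x => skewPart (f x) := by
  unfold skewPart
  fun_prop

/-- The properties of the step distribution of a small random walk on `SO(N)` of step size `s`
that are used to prove concentration. -/
structure IsStep (ν : Measure (SO N)) (s : ℝ) : Prop where
  prob : IsProbabilityMeasure ν
  inv : ν.map (fun q => q⁻¹) = ν
  conj : ∀ a : SO N, ν.map (fun q => a⁻¹ * q * a) = ν
  comm : ∀ A : Matrix (Fin N) (Fin N) ℝ, Aᵀ = -A →
    4 * (s ^ 2 * ((N : ℝ) - 2) / N ^ 2) * ip A A ≤ ∫ q, ip (A * q.1 - q.1 * A)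
      (A * q.1 - q.1 * A) ∂ν
  grad : ∀ (D : Matrix (Fin N) (Fin N) ℝ) (l : ℝ),
    (∀ A : Matrix (Fin N) (Fin N) ℝ, Aᵀ = -A → |ip D A| ≤ l * hs A) →
      ∫ q : SO N, ip D (skewPart q) ^ 2 ∂ν ≤ 4 * s ^ 2 * l ^ 2 / N ^ 2
  near : ∀ᵐ q : SO N ∂ν, hs (q.1 - 1 - skewPart q) ≤ 4 * s ^ 2
  small : ∀ᵐ q : SO N ∂ν, hs (skewPart q.1) ≤ 2 * s

/-- The rotation of sine `s` and positive cosine in a coordinate plane. -/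
noncomputable def smallRot (i j : Fin N) (s : ℝ) (hs : s ∈ Icc (-1 : ℝ) 1) : SO N :=
  ⟨rot i j (Real.sqrt (1 - s ^ 2)) s, rot_mem_SO i j (by
    rw [Real.sq_sqrt (by nlinarith [hs.1, hs.2])]; ring)⟩

lemma smallRot_inv (i j : Fin N) (s : ℝ) (hs : s ∈ Icc (-1 : ℝ) 1) :
    (smallRot i j s hs)⁻¹ = smallRot j i s hs := by
  apply Subtype.ext
  rw [coe_inv_SO]
  simp only [smallRot, rot_transpose, rot_swap i j]

/-- The law of a rotation of sine `s` in a uniformly random plane (or the identity). -/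
noncomputable def stepMeasure (μ : Measure (SO N)) (s : ℝ) (hs : s ∈ Icc (-1 : ℝ) 1) :
    Measure (SO N) :=
  ∑ i : Fin N, ∑ j : Fin N,
    ENNReal.ofReal (1 / (N : ℝ) ^ 2) • μ.map fun w => w⁻¹ * smallRot i j s hs * w

lemma integral_stepMeasure (μ : Measure (SO N)) [IsProbabilityMeasure μ] (s : ℝ)
    (hs : s ∈ Icc (-1 : ℝ) 1) {f : SO N → ℝ} (hf : Continuous f) :
    ∫ q, f q ∂(stepMeasure μ s hs) =
      1 / (N : ℝ) ^ 2 * ∑ i, ∑ j, ∫ w, f (w⁻¹ * smallRot i j s hs * w) ∂μ := by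
  have hm : ∀ i j : Fin N, Continuous fun w : SO N => w⁻¹ * smallRot i j s hs * w :=
    fun i j => by fun_prop
  have : ∀ i j : Fin N, IsProbabilityMeasure (μ.map fun w => w⁻¹ * smallRot i j s hs * w) :=
    fun i j => Measure.isProbabilityMeasure_map (hm i j).aemeasurable
  have hint : ∀ i j : Fin N, Integrable f
      (ENNReal.ofReal (1 / (N : ℝ) ^ 2) • μ.map fun w => w⁻¹ * smallRot i j s hs * w) :=
    fun i j => (integrable_SO _ hf).smul_measure ENNReal.ofReal_ne_top
  rw [stepMeasure, integral_finsetSum_measure fun i _ =>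
    integrable_finsetSum_measure.2 fun j _ => hint i j, Finset.mul_sum]
  refine Finset.sum_congr rfl fun i _ => ?_
  rw [integral_finsetSum_measure fun j _ => hint i j, Finset.mul_sum]
  refine Finset.sum_congr rfl fun j _ => ?_
  rw [integral_smul_measure, integral_map (hm i j).aemeasurable hf.aestronglyMeasurable,
    ENNReal.toReal_ofReal (by positivity), smul_eq_mul]

lemma ae_stepMeasure (μ : Measure (SO N)) (s : ℝ)
    (hs : s ∈ Icc (-1 : ℝ) 1) {p : SO N → Prop} (hp : MeasurableSet {q | p q})
    (h : ∀ (w : SO N) (i j : Fin N), p (w⁻¹ * smallRot i j s hs * w)) :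
    ∀ᵐ q ∂(stepMeasure μ s hs), p q := by
  have hm : ∀ i j : Fin N, Continuous fun w : SO N => w⁻¹ * smallRot i j s hs * w :=
    fun i j => by fun_prop
  rw [stepMeasure, ae_finsetSum_measure_iff]
  intro i _
  rw [ae_finsetSum_measure_iff]
  intro j _
  refine Measure.ae_smul_measure ?_ _
  rw [ae_map_iff (hm i j).aemeasurable hp]
  exact ae_of_all _ fun w => h w i j

lemma map_finsetSum {α β ι : Type*} [MeasurableSpace α] [MeasurableSpace β] (t : Finset ι)
    (m : ι → Measure α) {f : α → β} (hf : Measurable f) :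
    (∑ i ∈ t, m i).map f = ∑ i ∈ t, (m i).map f := by
  classical
  induction t using Finset.induction_on with
  | empty => simp
  | insert a t ha ih => rw [Finset.sum_insert ha, Finset.sum_insert ha, Measure.map_add _ _ hf, ih]

lemma skewPart_rot (i j : Fin N) (a b : ℝ) : skewPart (rot i j a b) = b • gen i j := by
  rw [skewPart, rot_transpose]
  simp only [rot]
  module

lemma skewPart_conj (w : SO N) (M : Matrix (Fin N) (Fin N) ℝ) :
    skewPart (w.1ᵀ * M * w.1) =
      w.1ᵀ * skewPart M * w.1 := by
  simp only [skewPart, Matrix.transpose_mul, Matrix.transpose_transpose, mul_smul_comm,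
    smul_mul_assoc, mul_sub, sub_mul, mul_assoc]

lemma coe_conj (w q : SO N) : (w⁻¹ * q * w : SO N).1 =
    w.1ᵀ * q.1 * w.1 := rfl

lemma hs_conj (w : SO N) (M : Matrix (Fin N) (Fin N) ℝ) :
    hs (w.1ᵀ * M * w.1) = hs M := by
  rw [hs_mul_orth _ _ (SO_mul_transpose w), hs_orth_mul]
  rw [Matrix.transpose_transpose, SO_mul_transpose]

theorem isStep_stepMeasure (hN : N ≠ 0) (μ : Measure (SO N)) [IsProbabilityMeasure μ]
    [μ.IsMulLeftInvariant] (s : ℝ) (h0 : 0 ≤ s)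
    (hs' : s ∈ Icc (-1 : ℝ) 1) : IsStep (stepMeasure μ s hs') s := by
  have h1 : s ≤ 1 := hs'.2
  have hN' : (0 : ℝ) < N := Nat.cast_pos.2 (Nat.pos_of_ne_zero hN)
  have hm : ∀ i j : Fin N, Continuous fun w : SO N => w⁻¹ * smallRot i j s hs' * w :=
    fun i j => by fun_prop
  refine ⟨⟨?_⟩, ?_, fun g => ?_, fun A hA => ?_, fun D l hD => ?_, ?_, ?_⟩
  · have : ∀ i j : Fin N, IsProbabilityMeasure (μ.map fun w => w⁻¹ * smallRot i j s hs' * w) :=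
      fun i j => Measure.isProbabilityMeasure_map (hm i j).aemeasurable
    simp only [stepMeasure, Measure.coe_finsetSum, Finset.sum_apply, Measure.smul_apply,
      measure_univ, smul_eq_mul, mul_one, Finset.sum_const, Finset.card_univ, Fintype.card_fin]
    rw [nsmul_eq_mul, nsmul_eq_mul, ← mul_assoc, ← ENNReal.ofReal_natCast,
      ← ENNReal.ofReal_mul hN'.le, ← ENNReal.ofReal_mul (by positivity), ← ENNReal.ofReal_one]
    congr 1
    field_simp
  · unfold stepMeasure
    rw [map_finsetSum _ _ continuous_inv.measurable]
    simp only [map_finsetSum _ _ (continuous_inv (G := SO N)).measurable]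
    rw [Finset.sum_comm]
    refine Finset.sum_congr rfl fun i _ => Finset.sum_congr rfl fun j _ => ?_
    rw [Measure.map_smul, Measure.map_map continuous_inv.measurable (hm j i).measurable]
    congr 2
    funext w
    simp only [Function.comp, _root_.mul_inv_rev, inv_inv, smallRot_inv, mul_assoc]
  · have hg : Continuous fun q : SO N => g⁻¹ * q * g := by fun_prop
    simp only [stepMeasure, map_finsetSum _ _ hg.measurable]
    refine Finset.sum_congr rfl fun i _ => Finset.sum_congr rfl fun j _ => ?_
    rw [Measure.map_smul, Measure.map_map hg.measurable (hm i j).measurable]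
    congr 1
    conv_rhs => rw [← map_mul_right_eq_self μ g,
      Measure.map_map (hm i j).measurable (continuous_mul_const g).measurable]
    congr 1
    funext w
    simp only [Function.comp, _root_.mul_inv_rev, mul_assoc]
  · rw [integral_stepMeasure μ s hs' (by fun_prop)]
    have hc : ∀ i j : Fin N, Continuous fun w : SO N =>
        ip (A * (w⁻¹ * smallRot i j s hs' * w).1 -
            (w⁻¹ * smallRot i j s hs' * w).1 * A)
          (A * (w⁻¹ * smallRot i j s hs' * w).1 -
            (w⁻¹ * smallRot i j s hs' * w).1 * A) :=
      fun i j => by fun_prop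
    have key : ∀ w : SO N, s ^ 2 * (4 * ((N : ℝ) - 2)) * ip A A ≤ ∑ i, ∑ j,
        ip (A * (w⁻¹ * smallRot i j s hs' * w).1 -
            (w⁻¹ * smallRot i j s hs' * w).1 * A)
          (A * (w⁻¹ * smallRot i j s hs' * w).1 -
            (w⁻¹ * smallRot i j s hs' * w).1 * A) := by
      intro w
      set W : Matrix (Fin N) (Fin N) ℝ := w.1 with hW
      have hW1 : W * Wᵀ = 1 := SO_mul_transpose w
      have hW2 : Wᵀ * W = 1 := SO_transpose_mul w
      have hB : (W * A * Wᵀ)ᵀ = -(W * A * Wᵀ) := by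
        simp only [Matrix.transpose_mul, Matrix.transpose_transpose, hA, mul_neg, neg_mul,
          mul_assoc]
      have hAA : ip (W * A * Wᵀ) (W * A * Wᵀ) = ip A A := by
        rw [ip_mul_orth, ip_orth_mul _ _ _ hW2]
        rw [Matrix.transpose_transpose, hW2]
      have h := sum_commutator_rot_ge hB (Real.sqrt (1 - s ^ 2)) s
      rw [hAA] at h
      refine h.trans (le_of_eq (Finset.sum_congr rfl fun i _ => Finset.sum_congr rfl fun j _ => ?_))
      have e : A * (w⁻¹ * smallRot i j s hs' * w).1 -
          (w⁻¹ * smallRot i j s hs' * w).1 * A =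
          Wᵀ * (W * A * Wᵀ * rot i j (Real.sqrt (1 - s ^ 2)) s -
            rot i j (Real.sqrt (1 - s ^ 2)) s * (W * A * Wᵀ)) * W := by
        rw [coe_conj]
        change A * (Wᵀ * rot i j (Real.sqrt (1 - s ^ 2)) s * W) -
          Wᵀ * rot i j (Real.sqrt (1 - s ^ 2)) s * W * A = _
        simp only [mul_sub, sub_mul, mul_assoc, hW2, mul_one]
        simp only [← mul_assoc, hW2, one_mul]
      rw [e, ip_mul_orth _ _ _ hW1, ip_orth_mul]
      rw [Matrix.transpose_transpose, hW1]
    have h2 : s ^ 2 * (4 * ((N : ℝ) - 2)) * ip A A ≤ ∫ w, (∑ i, ∑ j,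
        ip (A * (w⁻¹ * smallRot i j s hs' * w).1 -
            (w⁻¹ * smallRot i j s hs' * w).1 * A)
          (A * (w⁻¹ * smallRot i j s hs' * w).1 -
            (w⁻¹ * smallRot i j s hs' * w).1 * A)) ∂μ := by
      calc _ = ∫ _ : SO N, s ^ 2 * (4 * ((N : ℝ) - 2)) * ip A A ∂μ := by simp
        _ ≤ _ := integral_mono (integrable_const _)
          (integrable_SO μ (continuous_finsetSum _ fun i _ => continuous_finsetSum _ fun j _ =>
            hc i j)) key
    rw [integral_finsetSum _ fun i _ => integrable_SO μ (continuous_finsetSum _ fun j _ => hc i j)]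
      at h2
    simp only [integral_finsetSum Finset.univ fun j _ => integrable_SO μ (hc _ j)] at h2
    calc _ = 1 / (N : ℝ) ^ 2 * (s ^ 2 * (4 * ((N : ℝ) - 2)) * ip A A) := by field_simp
      _ ≤ _ := mul_le_mul_of_nonneg_left h2 (by positivity)
  · rw [integral_stepMeasure μ s hs' (by fun_prop)]
    have hc : ∀ i j : Fin N, Continuous fun w : SO N =>
        ip D (skewPart (w⁻¹ * smallRot i j s hs' * w).1) ^ 2 :=
      fun i j => by fun_prop
    have key : ∀ w : SO N, ∑ i, ∑ j,
        ip D (skewPart (w⁻¹ * smallRot i j s hs' * w).1) ^ 2 ≤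
          s ^ 2 * (4 * l ^ 2) := by
      intro w
      have e : ∀ i j, ip D (skewPart (w⁻¹ * smallRot i j s hs' * w).1) = s * ip (w.1 * D *
            w.1ᵀ) (gen i j) := fun i j => by
        rw [coe_conj, skewPart_conj, smallRot, skewPart_rot, ip_mul_right, ip_mul_left,
          Matrix.transpose_transpose, ip_smul_right, mul_assoc]
      simp only [e, mul_pow, ← Finset.mul_sum]
      refine mul_le_mul_of_nonneg_left (sum_ip_gen_sq_le fun A hA => ?_) (sq_nonneg s)
      have h := hD (w.1ᵀ * A * w.1) (by
        simp only [Matrix.transpose_mul, Matrix.transpose_transpose, hA, mul_neg, neg_mul,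
          mul_assoc])
      rwa [hs_conj, ip_mul_right, ip_mul_left, Matrix.transpose_transpose, ← mul_assoc] at h
    have h2 : ∫ w, (∑ i, ∑ j, ip D (skewPart (w⁻¹ * smallRot i j s hs' * w).1) ^ 2) ∂μ ≤
        s ^ 2 * (4 * l ^ 2) := by
      refine (integral_mono
        (integrable_SO μ (continuous_finsetSum _ fun i _ => continuous_finsetSum _ fun j _ =>
          hc i j)) (integrable_const (s ^ 2 * (4 * l ^ 2))) key).trans (le_of_eq ?_)
      simp
    rw [integral_finsetSum _ fun i _ => integrable_SO μ (continuous_finsetSum _ fun j _ => hc i j)]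
      at h2
    simp only [integral_finsetSum Finset.univ fun j _ => integrable_SO μ (hc _ j)] at h2
    refine (mul_le_mul_of_nonneg_left h2 (by positivity)).trans (le_of_eq ?_)
    field_simp
  · refine ae_stepMeasure μ s hs' (isClosed_le (by fun_prop) (by fun_prop)).measurableSet
      fun w i j => ?_
    have e : (w⁻¹ * smallRot i j s hs' * w).1 - 1 -
        skewPart (w⁻¹ * smallRot i j s hs' * w).1 =
        w.1ᵀ *
          ((1 - Real.sqrt (1 - s ^ 2)) • (gen i j * gen i j)) * w.1 := by
      rw [coe_conj, skewPart_conj, smallRot, skewPart_rot]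
      simp only [rot, mul_add, add_mul, mul_one, SO_transpose_mul]
      abel
    have hsq : s ^ 2 ≤ 1 := pow_le_one₀ h0 h1
    have hs2 : 1 - s ^ 2 ≤ Real.sqrt (1 - s ^ 2) :=
      Real.le_sqrt_of_sq_le
        (by nlinarith [sq_nonneg s, mul_nonneg (sq_nonneg s) (sub_nonneg.2 hsq)])
    have hs1 : Real.sqrt (1 - s ^ 2) ≤ 1 := Real.sqrt_le_one.2 (by nlinarith [sq_nonneg s])
    rw [e, hs_conj, hs_smul, abs_of_nonneg (by linarith)]
    have := hs_mul_le (gen i j) (gen i j)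
    have h2 := hs_gen_le i j
    have h3 := hs_nonneg (gen i j)
    have h4 : hs (gen i j * gen i j) ≤ 4 := by nlinarith
    calc _ ≤ s ^ 2 * 4 := mul_le_mul (by linarith) h4 (hs_nonneg _) (sq_nonneg s)
      _ = _ := mul_comm _ _
  · refine ae_stepMeasure μ s hs' (isClosed_le (by fun_prop) (by fun_prop)).measurableSet
      fun w i j => ?_
    rw [coe_conj, skewPart_conj, hs_conj, smallRot, skewPart_rot, hs_smul, abs_of_nonneg h0]
    nlinarith [hs_gen_le i j]

/-! ### Averaging a differentiable function along the walk -/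

/-- `D` is a continuous gradient field of `g`, bounded by `L`, with quadratic Taylor remainder
controlled by `K`, and with tangential size on `SO(N)` bounded by `l`. -/
structure IsGradient (g : Matrix (Fin N) (Fin N) ℝ → ℝ)
    (D : Matrix (Fin N) (Fin N) ℝ → Matrix (Fin N) (Fin N) ℝ) (L K l : ℝ) : Prop where
  L_nonneg : 0 ≤ L
  K_nonneg : 0 ≤ K
  l_nonneg : 0 ≤ l
  cont : Continuous g
  contD : Continuous D
  lip : ∀ x h, |ip (D x) h| ≤ L * hs h
  taylor : ∀ x h, |g (x + h) - g x - ip (D x) h| ≤ K * ip h h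
  tang : ∀ (x : SO N) (A : Matrix (Fin N) (Fin N) ℝ), Aᵀ = -A → |ip (D x.1) (x.1 * A)| ≤ l * hs A

/-- The average of `g` over one step of the walk. -/
noncomputable def avg (ν : Measure (SO N)) (g : Matrix (Fin N) (Fin N) ℝ → ℝ)
    (x : Matrix (Fin N) (Fin N) ℝ) : ℝ := ∫ q : SO N, g (x * q.1) ∂ν

/-- The gradient of the average of a function with gradient `D`. -/
noncomputable def avgGrad (ν : Measure (SO N))
    (D : Matrix (Fin N) (Fin N) ℝ → Matrix (Fin N) (Fin N) ℝ)
    (x : Matrix (Fin N) (Fin N) ℝ) : Matrix (Fin N) (Fin N) ℝ :=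
  Matrix.of fun a b => ∫ q : SO N, (D (x * q.1) * q.1ᵀ) a b ∂ν

lemma ip_avgGrad (ν : Measure (SO N)) [IsProbabilityMeasure ν]
    {D : Matrix (Fin N) (Fin N) ℝ → Matrix (Fin N) (Fin N) ℝ} (hD : Continuous D)
    (x h : Matrix (Fin N) (Fin N) ℝ) :
    ip (avgGrad ν D x) h = ∫ q : SO N, ip (D (x * q.1)) (h * q.1) ∂ν := by
  have hc : ∀ a b, Continuous fun q : SO N => (D (x * q.1) * q.1ᵀ) a b * h a b := fun a b => by
    refine (Continuous.matrix_elem ?_ a b).mul continuous_const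
    fun_prop
  simp only [ip_mul_right]
  simp only [ip]
  rw [integral_finsetSum _ fun a _ => integrable_SO ν (continuous_finsetSum _ fun b _ => hc a b)]
  refine Finset.sum_congr rfl fun a _ => ?_
  rw [integral_finsetSum _ fun b _ => integrable_SO ν (hc a b)]
  refine Finset.sum_congr rfl fun b _ => ?_
  rw [integral_mul_const]
  rfl

lemma abs_integral_le_of_forall (ν : Measure (SO N)) [IsProbabilityMeasure ν] {f : SO N → ℝ}
    {C : ℝ} (h : ∀ q, |f q| ≤ C) : |∫ q, f q ∂ν| ≤ C := by
  have := norm_integral_le_of_norm_le_const (μ := ν) (f := f) (C := C)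
    (ae_of_all _ fun q => (Real.norm_eq_abs _).trans_le (h q))
  simpa using this

lemma sq_integral_le (ν : Measure (SO N)) [IsProbabilityMeasure ν] {f : SO N → ℝ}
    (hf : Continuous f) : (∫ q, f q ∂ν) ^ 2 ≤ ∫ q, f q ^ 2 ∂ν := by
  have h0 : 0 ≤ ∫ q, (f q - ∫ q, f q ∂ν) ^ 2 ∂ν := integral_nonneg fun q => sq_nonneg _
  have h1 : ∀ q, (f q - ∫ q, f q ∂ν) ^ 2 =
      f q ^ 2 - 2 * (∫ q, f q ∂ν) * f q + (∫ q, f q ∂ν) ^ 2 := fun q => by ring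
  simp only [h1] at h0
  rw [integral_add (integrable_SO ν (by fun_prop)) (integrable_const _),
    integral_sub (integrable_SO ν (by fun_prop)) (integrable_SO ν (by fun_prop)),
    integral_const_mul, integral_const] at h0
  simp only [probReal_univ, smul_eq_mul, one_mul] at h0
  linarith

lemma one_sub_sqrt_le {t : ℝ} (h0 : 0 ≤ t) (h1 : t ≤ 1) :
    0 ≤ 1 - Real.sqrt (1 - t ^ 2) ∧ 1 - Real.sqrt (1 - t ^ 2) ≤ t ^ 2 := by
  have hsq : t ^ 2 ≤ 1 := pow_le_one₀ h0 h1
  have h2 : 1 - t ^ 2 ≤ Real.sqrt (1 - t ^ 2) :=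
    Real.le_sqrt_of_sq_le (by nlinarith [sq_nonneg t, mul_nonneg (sq_nonneg t) (sub_nonneg.2 hsq)])
  have h3 : Real.sqrt (1 - t ^ 2) ≤ 1 := Real.sqrt_le_one.2 (by nlinarith [sq_nonneg t])
  constructor <;> linarith

lemma IsGradient.conj_expansion {g : Matrix (Fin N) (Fin N) ℝ → ℝ}
    {D : Matrix (Fin N) (Fin N) ℝ → Matrix (Fin N) (Fin N) ℝ} {L K l : ℝ}
    (hg : IsGradient g D L K l) (x q : SO N) (i j : Fin N) {t : ℝ} (h0 : 0 ≤ t)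
    (ht : t ∈ Icc (-1 : ℝ) 1) :
    |g (x * ((smallRot i j t ht)⁻¹ * q * smallRot i j t ht)).1 - g (x * q).1 -
      t * ip (D (x.1 * q.1)) (x.1 * (q.1 * gen i j - gen i j * q.1))| ≤
        (144 * K + 32 * L) * t ^ 2 := by
  obtain ⟨c0, c1⟩ := one_sub_sqrt_le h0 ht.2
  set c := Real.sqrt (1 - t ^ 2) with hc
  set E := gen i j with hE
  set a := rot i j c t with ha
  have haSO : a * aᵀ = 1 := SO_mul_transpose (smallRot i j t ht)
  set C1 := q.1 * E - E * q.1 with hC1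
  set C2 := q.1 * (E * E) - E * E * q.1 with hC2
  have hE2 : hs (E * E) ≤ 4 := by
    have := hs_mul_le E E
    have h2 : hs E ≤ 2 := hs_gen_le i j
    nlinarith [hs_nonneg E]
  have hE1 : hs E ≤ 2 := hs_gen_le i j
  have b1 : hs C1 ≤ 4 := by
    refine (hs_sub_le _ _).trans ?_
    rw [hs_orth_mul _ _ (SO_transpose_mul q), hs_mul_orth _ _ (SO_mul_transpose q)]
    linarith
  have b2 : hs C2 ≤ 8 := by
    refine (hs_sub_le _ _).trans ?_
    rw [hs_orth_mul _ _ (SO_transpose_mul q), hs_mul_orth _ _ (SO_mul_transpose q)]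
    linarith
  have hrot : q.1 * a - a * q.1 = t • C1 + (1 - c) • C2 := by
    simp only [ha, rot, hC1, hC2, mul_add, add_mul, mul_one, one_mul, mul_smul_comm,
      smul_mul_assoc, smul_sub, ← hE]
    abel
  set h := x.1 * (aᵀ * (t • C1 + (1 - c) • C2)) with hh
  have ex : (x * ((smallRot i j t ht)⁻¹ * q * smallRot i j t ht)).1 = x.1 * q.1 + h := by
    change x.1 * (aᵀ * q.1 * a) = _
    rw [hh, ← hrot, ← mul_add]
    congr 1
    rw [mul_sub, ← mul_assoc aᵀ a, mul_eq_one_comm.1 haSO, one_mul, mul_assoc]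
    abel
  have bh : hs h ≤ 12 * t := by
    rw [hh, hs_orth_mul _ _ (SO_transpose_mul x), hs_orth_mul _ aᵀ (by
      rw [Matrix.transpose_transpose, haSO])]
    refine (hs_add_le _ _).trans ?_
    rw [hs_smul, hs_smul, abs_of_nonneg h0, abs_of_nonneg c0]
    have t1 : t ^ 2 ≤ t := by nlinarith [ht.2]
    nlinarith [hs_nonneg C1, hs_nonneg C2]
  have hsplit : h = t • (x.1 * C1) + (x.1 * ((1 - c) • (aᵀ * C2)) +
      x.1 * (t • ((aᵀ - 1) * C1))) := by
    rw [hh]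
    simp only [mul_add, sub_mul, one_mul, mul_smul_comm, smul_sub, mul_sub]
    abel
  set R := x.1 * ((1 - c) • (aᵀ * C2)) + x.1 * (t • ((aᵀ - 1) * C1)) with hR
  have ba : hs (aᵀ - 1) ≤ 6 * t := by
    have e : aᵀ - 1 = (1 - c) • (E * E) - t • E := by
      rw [ha, rot_transpose]
      simp only [rot, neg_smul]
      abel
    rw [e]
    refine (hs_sub_le _ _).trans ?_
    rw [hs_smul, hs_smul, abs_of_nonneg h0, abs_of_nonneg c0]
    have t1 : t ^ 2 ≤ t := by nlinarith [ht.2]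
    nlinarith [hs_nonneg E, hs_nonneg (E * E)]
  have bR : hs R ≤ 32 * t ^ 2 := by
    refine (hs_add_le _ _).trans ?_
    rw [hs_orth_mul _ _ (SO_transpose_mul x), hs_orth_mul _ _ (SO_transpose_mul x), hs_smul,
      hs_smul, hs_orth_mul _ aᵀ (by rw [Matrix.transpose_transpose, haSO]), abs_of_nonneg h0,
      abs_of_nonneg c0]
    have e1 : hs ((aᵀ - 1) * C1) ≤ 6 * t * 4 :=
      (hs_mul_le _ _).trans (mul_le_mul ba b1 (hs_nonneg _) (by positivity))
    have e2 : t * hs ((aᵀ - 1) * C1) ≤ t * (6 * t * 4) := mul_le_mul_of_nonneg_left e1 h0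
    have e3 : (1 - c) * hs C2 ≤ t ^ 2 * 8 := mul_le_mul c1 b2 (hs_nonneg _) (sq_nonneg _)
    nlinarith
  have T := hg.taylor (x.1 * q.1) h
  have Lp := hg.lip (x.1 * q.1) R
  have ihh : ip h h ≤ 144 * t ^ 2 := by
    rw [← hs_sq]
    nlinarith [hs_nonneg h]
  have e4 : ip (D (x.1 * q.1)) h = t * ip (D (x.1 * q.1)) (x.1 * C1) + ip (D (x.1 * q.1)) R := by
    rw [hsplit, ip_add_right, ip_smul_right]
  rw [ex]
  change |g (x.1 * q.1 + h) - g (x.1 * q.1) - t * ip (D (x.1 * q.1)) (x.1 * C1)| ≤ _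
  have e5 : K * ip h h ≤ K * (144 * t ^ 2) := mul_le_mul_of_nonneg_left ihh hg.K_nonneg
  have e6 : L * hs R ≤ L * (32 * t ^ 2) := mul_le_mul_of_nonneg_left bR hg.L_nonneg
  rw [abs_le] at T Lp ⊢
  constructor <;> linarith [T.1, T.2, Lp.1, Lp.2]

lemma eq_zero_of_forall_mul_le {I C : ℝ} (h : ∀ t, 0 < t → t ≤ 1 → |t * I| ≤ C * t ^ 2) :
    I = 0 := by
  by_contra hI
  have hI' : 0 < |I| := abs_pos.2 hI
  have hC : 0 < C := by
    have := h 1 one_pos le_rfl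
    simp only [one_mul, one_pow, mul_one] at this
    linarith
  have hb : ∀ t, 0 < t → t ≤ 1 → |I| ≤ C * t := fun t h0 h1 => by
    have := h t h0 h1
    rw [abs_mul, abs_of_pos h0] at this
    nlinarith
  have h1 := hb 1 one_pos le_rfl
  have ht : 0 < |I| / (2 * C) := by positivity
  have ht1 : |I| / (2 * C) ≤ 1 := by rw [div_le_one (by positivity)]; linarith
  have := hb _ ht ht1
  have e : C * (|I| / (2 * C)) = |I| / 2 := by field_simp
  linarith

lemma IsGradient.integral_commutator_gen {ν : Measure (SO N)} {s : ℝ} (hν : IsStep ν s)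
    {g : Matrix (Fin N) (Fin N) ℝ → ℝ}
    {D : Matrix (Fin N) (Fin N) ℝ → Matrix (Fin N) (Fin N) ℝ} {L K l : ℝ}
    (hg : IsGradient g D L K l) (x : SO N) (i j : Fin N) :
    ∫ q : SO N, ip (D (x.1 * q.1)) (x.1 * (q.1 * gen i j - gen i j * q.1)) ∂ν = 0 := by
  have := hν.prob
  have hgc := hg.cont
  have hDc := hg.contD
  refine eq_zero_of_forall_mul_le (C := 144 * K + 32 * L) fun t h0 h1 => ?_
  have ht : t ∈ Icc (-1 : ℝ) 1 := ⟨by linarith, h1⟩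
  have e := hν.conj (smallRot i j t ht)
  have hm : Continuous fun q : SO N => (smallRot i j t ht)⁻¹ * q * smallRot i j t ht := by fun_prop
  have e1 : ∫ q : SO N, g (x * ((smallRot i j t ht)⁻¹ * q * smallRot i j t ht)).1 ∂ν =
      ∫ q : SO N, g (x * q).1 ∂ν := by
    conv_rhs => rw [← e]
    rw [integral_map hm.aemeasurable]
    exact (Continuous.aestronglyMeasurable (by fun_prop))
  have hb := abs_integral_le_of_forall ν fun q => hg.conj_expansion x q i j h0.le ht
  rw [integral_sub (integrable_SO ν (by fun_prop)) (integrable_SO ν (by fun_prop)),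
    integral_sub (integrable_SO ν (by fun_prop)) (integrable_SO ν (by fun_prop)), e1, sub_self,
    zero_sub, abs_neg, integral_const_mul] at hb
  exact hb

lemma IsGradient.integral_commutator {ν : Measure (SO N)} {s : ℝ} (hν : IsStep ν s)
    {g : Matrix (Fin N) (Fin N) ℝ → ℝ}
    {D : Matrix (Fin N) (Fin N) ℝ → Matrix (Fin N) (Fin N) ℝ} {L K l : ℝ}
    (hg : IsGradient g D L K l) (x : SO N) {A : Matrix (Fin N) (Fin N) ℝ} (hA : Aᵀ = -A) :
    ∫ q : SO N, ip (D (x.1 * q.1)) (x.1 * (q.1 * A - A * q.1)) ∂ν = 0 := by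
  have := hν.prob
  have hDc := hg.contD
  have e : ∀ q : SO N, ip (D (x.1 * q.1)) (x.1 * (q.1 * A - A * q.1)) = ∑ i, ∑ j,
      A i j / 2 * ip (D (x.1 * q.1)) (x.1 * (q.1 * gen i j - gen i j * q.1)) := fun q => by
    conv_lhs => rw [skew_eq_sum_gen hA]
    simp only [Finset.mul_sum, Finset.sum_mul, ← Finset.sum_sub_distrib, ip_sum_right,
      mul_smul_comm, smul_mul_assoc, ← smul_sub, ip_smul_right]
  simp only [e]
  rw [integral_finsetSum _ fun i _ => integrable_SO ν (by fun_prop)]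
  refine Finset.sum_eq_zero fun i _ => ?_
  rw [integral_finsetSum _ fun j _ => integrable_SO ν (by fun_prop)]
  refine Finset.sum_eq_zero fun j _ => ?_
  rw [integral_const_mul, hg.integral_commutator_gen hν, mul_zero]

lemma ip_average_conj (q : SO N) (A : Matrix (Fin N) (Fin N) ℝ) :
    ip ((1 / 2 : ℝ) • (q.1ᵀ * (A * q.1 + q.1 * A))) ((1 / 2 : ℝ) • (q.1ᵀ * (A * q.1 + q.1 * A))) =
      ip A A - 1 / 4 * ip (A * q.1 - q.1 * A) (A * q.1 - q.1 * A) := by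
  rw [ip_smul_left, ip_smul_right, ip_orth_mul _ _ _ (by
    rw [Matrix.transpose_transpose, SO_mul_transpose])]
  simp only [ip_add_left, ip_add_right, ip_sub_left, ip_sub_right,
    ip_orth_mul _ _ _ (SO_transpose_mul q), ip_mul_orth _ _ _ (SO_mul_transpose q)]
  ring

theorem IsGradient.average {ν : Measure (SO N)} {s : ℝ} (hν : IsStep ν s)
    {g : Matrix (Fin N) (Fin N) ℝ → ℝ}
    {D : Matrix (Fin N) (Fin N) ℝ → Matrix (Fin N) (Fin N) ℝ} {L K l : ℝ}
    (hg : IsGradient g D L K l) {ρ : ℝ} (hρ : 0 ≤ ρ)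
    (hρ2 : 1 - s ^ 2 * ((N : ℝ) - 2) / N ^ 2 ≤ ρ ^ 2) :
    IsGradient (avg ν g) (avgGrad ν D) L K (ρ * l) := by
  have := hν.prob
  have hgc := hg.cont
  have hDc := hg.contD
  refine ⟨hg.L_nonneg, hg.K_nonneg, mul_nonneg hρ hg.l_nonneg, ?_, ?_, fun x h => ?_,
    fun x h => ?_, fun x A hA => ?_⟩
  · exact continuous_integral_SO ν (by fun_prop)
  · refine continuous_matrix fun a b => continuous_integral_SO ν ?_
    refine Continuous.matrix_elem (A := fun p : Matrix (Fin N) (Fin N) ℝ × SO N =>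
      D (p.1 * p.2.1) * p.2.1ᵀ) ?_ a b
    fun_prop
  · rw [ip_avgGrad ν hDc]
    refine abs_integral_le_of_forall ν fun q => ?_
    rw [← hs_mul_orth h _ (SO_mul_transpose q)]
    exact hg.lip _ _
  · rw [ip_avgGrad ν hDc, avg, avg, ← integral_sub (integrable_SO ν (by fun_prop))
      (integrable_SO ν (by fun_prop)), ← integral_sub (integrable_SO ν (by fun_prop))
      (integrable_SO ν (by fun_prop))]
    refine abs_integral_le_of_forall ν fun q => ?_
    rw [← ip_mul_orth h h _ (SO_mul_transpose q), add_mul]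
    exact hg.taylor _ _
  · rw [ip_avgGrad ν hDc]
    set B : SO N → Matrix (Fin N) (Fin N) ℝ := fun q =>
      (1 / 2 : ℝ) • (q.1ᵀ * (A * q.1 + q.1 * A)) with hB
    have hBc : Continuous B := by fun_prop
    have e : ∫ q : SO N, ip (D (x.1 * q.1)) (x.1 * A * q.1) ∂ν =
        ∫ q : SO N, ip (D (x * q).1) ((x * q).1 * B q) ∂ν := by
      rw [← add_zero (∫ q : SO N, ip (D (x.1 * q.1)) (x.1 * A * q.1) ∂ν),
        ← mul_zero (1 / 2 : ℝ), ← hg.integral_commutator hν x hA, ← integral_const_mul,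
        ← integral_add (integrable_SO ν (by fun_prop)) (integrable_SO ν (by fun_prop))]
      refine integral_congr_ae (ae_of_all _ fun q => ?_)
      change _ = ip (D (x.1 * q.1)) (x.1 * q.1 * B q)
      simp only
      rw [← ip_smul_right, ← ip_add_right]
      congr 1
      have e2 : q.1 * (q.1ᵀ * (A * q.1 + q.1 * A)) = A * q.1 + q.1 * A := by
        rw [← mul_assoc, SO_mul_transpose, one_mul]
      rw [hB]
      simp only [mul_smul_comm, mul_assoc, e2]
      simp only [mul_add, mul_sub]
      module
    have hBs : ∀ q, (B q)ᵀ = -B q := fun q => by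
      simp only [hB, Matrix.transpose_smul, Matrix.transpose_mul, Matrix.transpose_add, hA,
        Matrix.transpose_transpose, mul_add, mul_neg, neg_mul, ← mul_assoc,
        SO_transpose_mul, one_mul]
      simp only [mul_assoc]
      module
    have hm : |∫ q : SO N, ip (D (x * q).1) ((x * q).1 * B q) ∂ν| ≤ ∫ q : SO N, l * hs (B q) ∂ν :=
      (abs_integral_le_integral_abs).trans (integral_mono (integrable_SO ν (by fun_prop))
        (integrable_SO ν (by fun_prop)) fun q => hg.tang (x * q) (B q) (hBs q))
    have hJ : ∫ q : SO N, hs (B q) ∂ν ≤ ρ * hs A := by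
      refine (le_abs_self _).trans (abs_le_of_sq_le_sq ?_ (mul_nonneg hρ (hs_nonneg _)))
      refine (sq_integral_le ν (by fun_prop)).trans ?_
      simp only [hs_sq, hB, ip_average_conj]
      rw [integral_sub (integrable_const _) (integrable_SO ν (by fun_prop)), integral_const_mul,
        integral_const, mul_pow, hs_sq]
      simp only [probReal_univ, smul_eq_mul, one_mul]
      have h1 := hν.comm A hA
      have h2 := mul_le_mul_of_nonneg_right hρ2 (ip_self_nonneg A)
      linarith
    rw [e]
    rw [integral_const_mul] at hm
    calc _ ≤ _ := hm
      _ ≤ l * (ρ * hs A) := mul_le_mul_of_nonneg_left hJ hg.l_nonneg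
      _ = _ := by ring

/-! ### Generation of `SO(N)` by plane rotations -/

/-- The rotation of angle `θ` in a coordinate plane. -/
noncomputable def planeRot (i j : Fin N) (θ : ℝ) : SO N :=
  ⟨rot i j (Real.cos θ) (Real.sin θ), rot_mem_SO i j (Real.cos_sq_add_sin_sq θ)⟩

lemma planeRot_zero (i j : Fin N) : planeRot i j 0 = 1 :=
  Subtype.ext (by simp [planeRot, rot_one_zero])

lemma planeRot_mul (i j : Fin N) (θ φ : ℝ) :
    planeRot i j θ * planeRot i j φ = planeRot i j (θ + φ) := by
  apply Subtype.ext
  change rot i j _ _ * rot i j _ _ = rot i j _ _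
  rw [rot_mul, Real.cos_add, Real.sin_add]
  congr 1
  ring

lemma exists_planeRot_eq (i j : Fin N) {a b : ℝ} (h : a ^ 2 + b ^ 2 = 1) :
    ∃ θ, (planeRot i j θ).1 = rot i j a b := by
  have hz : ‖(⟨a, b⟩ : ℂ)‖ = 1 := by
    rw [Complex.norm_def, Complex.normSq_mk, Real.sqrt_eq_one]
    linarith
  refine ⟨Complex.arg ⟨a, b⟩, ?_⟩
  have hne : (⟨a, b⟩ : ℂ) ≠ 0 := by
    intro h0
    rw [h0, norm_zero] at hz
    exact zero_ne_one hz
  change rot i j _ _ = _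
  rw [Complex.cos_arg hne, Complex.sin_arg, hz, div_one, div_one]

lemma rot_eq_of_ne {i j : Fin N} (hij : i ≠ j) (a b : ℝ) :
    rot i j a b = 1 + b • (Matrix.single i j 1 - Matrix.single j i 1) +
      (1 - a) • (-Matrix.single i i 1 - Matrix.single j j 1) := by
  have h : gen i j * gen i j = -Matrix.single i i 1 - Matrix.single j j 1 := by
    simp only [gen, mul_sub, sub_mul]
    simp [hij, hij.symm]
    abel
  rw [rot, h, gen]

lemma rot_mul_apply {i j : Fin N} (hij : i ≠ j) (a b : ℝ) (V : Matrix (Fin N) (Fin N) ℝ)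
    (r c : Fin N) : (rot i j a b * V) r c =
      if r = i then a * V i c + b * V j c else if r = j then a * V j c - b * V i c else V r c := by
  have hs : ∀ p q : Fin N, (Matrix.single p q (1 : ℝ) * V) r c = if r = p then V q c else 0 :=
    fun p q => by
      split_ifs with h
      · subst h; simp
      · simp [h]
  rw [rot_eq_of_ne hij]
  simp only [add_mul, sub_mul, neg_mul, one_mul, smul_mul_assoc, Matrix.add_apply,
    Matrix.sub_apply, Matrix.neg_apply, Matrix.smul_apply, hs, smul_eq_mul]
  by_cases h1 : r = i
  · subst h1
    simp only [if_true, hij, if_false]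
    ring
  · by_cases h2 : r = j
    · subst h2
      simp only [if_true, h1, if_false]
      ring
    · simp [h1, h2]

lemma SO_col_sum (U : SO N) (c d : Fin N) :
    ∑ r, U.1 r c * U.1 r d = if c = d then 1 else 0 := by
  have := congrFun (congrFun (SO_transpose_mul U) c) d
  simpa [Matrix.mul_apply, Matrix.one_apply] using this

lemma exists_rotation_to_axis (p w : ℝ) :
    ∃ a b : ℝ, a ^ 2 + b ^ 2 = 1 ∧ a * w - b * p = 0 ∧ 0 ≤ a * p + b * w := by
  by_cases h : p ^ 2 + w ^ 2 = 0
  · have hp : p = 0 := by nlinarith [sq_nonneg p, sq_nonneg w]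
    have hw : w = 0 := by nlinarith [sq_nonneg p, sq_nonneg w]
    exact ⟨1, 0, by norm_num, by simp [hw], by simp [hp]⟩
  · have h0 : 0 < p ^ 2 + w ^ 2 := lt_of_le_of_ne (by positivity) (Ne.symm h)
    have hr : 0 < Real.sqrt (p ^ 2 + w ^ 2) := Real.sqrt_pos.2 h0
    have hr2 : Real.sqrt (p ^ 2 + w ^ 2) ^ 2 = p ^ 2 + w ^ 2 := Real.sq_sqrt h0.le
    refine ⟨p / Real.sqrt (p ^ 2 + w ^ 2), w / Real.sqrt (p ^ 2 + w ^ 2), ?_, ?_, ?_⟩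
    · rw [div_pow, div_pow, hr2, ← add_div, div_self h]
    · ring
    · rw [div_mul_eq_mul_div, div_mul_eq_mul_div, ← add_div]
      apply div_nonneg _ hr.le
      nlinarith

/-- Clearing a column of a special orthogonal matrix whose previous columns are trivial. -/
lemma induction_on_planeRot_column {P : SO N → Prop} (hmul : ∀ U V, P U → P V → P (U * V))
    (hrot : ∀ i j θ, P (planeRot i j θ)) {k : Fin N}
    (hk : ∀ U : SO N, (∀ r c : Fin N, c ≤ k → U.1 r c = (1 : Matrix (Fin N) (Fin N) ℝ) r c) → P U)
    (d m : ℕ) (hm : k < m) (hd : m + d = N) (U : SO N)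
    (h1 : ∀ r c : Fin N, c < k → U.1 r c = (1 : Matrix (Fin N) (Fin N) ℝ) r c)
    (h2 : ∀ r : Fin N, k < r → (r : ℕ) < m → U.1 r k = 0)
    (h3 : (k : ℕ) + 1 < m → 0 ≤ U.1 k k) : P U := by
  induction d generalizing m U with
  | zero =>
    have hlow : ∀ r : Fin N, r < k → U.1 r k = 0 := fun r hr => by
      have := SO_col_sum U r k
      rw [if_neg hr.ne] at this
      simpa [h1 _ r hr, Matrix.one_apply] using this
    have hoff : ∀ r : Fin N, r ≠ k → U.1 r k = 0 := fun r hr => by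
      rcases lt_or_gt_of_ne hr with h | h
      · exact hlow r h
      · exact h2 r h (by omega)
    have hsq : U.1 k k * U.1 k k = 1 := by
      have := SO_col_sum U k k
      rw [if_pos rfl, Finset.sum_eq_single k (fun r _ hr => by rw [hoff r hr, zero_mul])
        (by simp)] at this
      exact this
    have hkk : U.1 k k = 1 := by
      by_cases hkm : (k : ℕ) + 1 < m
      · nlinarith [h3 hkm]
      · have hU : U.1 = Matrix.diagonal fun c => if c = k then U.1 k k else 1 := by
          refine Matrix.ext fun r c => ?_
          by_cases hc : c = k
          · subst hc
            by_cases hr : r = c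
            · subst hr; simp
            · simp [hoff r hr, hr]
          · have hck : c < k := by
              have := c.2
              have : (c : ℕ) ≠ k := fun h => hc (Fin.ext h)
              exact Fin.lt_def.2 (by omega)
            rw [h1 r c hck]
            by_cases hr : r = c
            · subst hr; simp [hc]
            · simp [hr]
        have hdet := (mem_SO.1 U.2).2
        rw [hU, Matrix.det_diagonal, Finset.prod_ite_eq' Finset.univ k fun _ => U.1 k k,
          if_pos (Finset.mem_univ k)] at hdet
        exact hdet
    refine hk U fun r c hc => ?_
    rcases lt_or_eq_of_le hc with h | h
    · exact h1 r c h
    · subst h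
      by_cases hr : r = c
      · subst hr; simpa using hkk
      · rw [hoff r hr, Matrix.one_apply_ne hr]
  | succ d ih =>
    have hmN : m < N := by omega
    set j : Fin N := ⟨m, hmN⟩ with hj
    have hkj : k ≠ j := fun h => by rw [h] at hm; exact lt_irrefl _ hm
    obtain ⟨a, b, hab, hz, hp⟩ := exists_rotation_to_axis (U.1 k k) (U.1 j k)
    obtain ⟨θ, hθ⟩ := exists_planeRot_eq k j hab
    have hV : ∀ r c, (planeRot k j θ * U).1 r c = if r = k then a * U.1 k c + b * U.1 j c
        else if r = j then a * U.1 j c - b * U.1 k c else U.1 r c := fun r c => by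
      change ((planeRot k j θ).1 * U.1) r c = _
      rw [hθ, rot_mul_apply hkj]
    have hPV : P (planeRot k j θ * U) := by
      refine ih (m + 1) (by omega) (by omega) _ (fun r c hc => ?_) (fun r hr hrm => ?_)
        fun _ => ?_
      · have hck : k ≠ c := hc.ne'
        have hcj : j ≠ c := fun h => by
          have := Fin.lt_def.1 hc
          rw [← h] at this
          simp only [hj] at this
          omega
        rw [hV]
        split_ifs with e1 e2
        · rw [h1 k c hc, h1 j c hc, Matrix.one_apply_ne hck, Matrix.one_apply_ne hcj, e1,
            Matrix.one_apply_ne hck]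
          ring
        · rw [h1 k c hc, h1 j c hc, Matrix.one_apply_ne hck, Matrix.one_apply_ne hcj, e2,
            Matrix.one_apply_ne hcj]
          ring
        · exact h1 r c hc
      · rw [hV, if_neg hr.ne']
        split_ifs with e
        · exact hz
        · exact h2 r hr (by
            have : (r : ℕ) ≠ m := fun h => e (Fin.ext h)
            omega)
      · rw [hV, if_pos rfl]
        exact hp
    have : U = planeRot k j (-θ) * (planeRot k j θ * U) := by
      rw [← mul_assoc, planeRot_mul, neg_add_cancel, planeRot_zero, one_mul]
    rw [this]
    exact hmul _ _ (hrot _ _ _) hPV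

/-- A multiplicative property holding for plane rotations holds on `SO(N)`. -/
theorem induction_on_planeRot {P : SO N → Prop} (hone : P 1)
    (hmul : ∀ U V, P U → P V → P (U * V)) (hrot : ∀ i j θ, P (planeRot i j θ)) (U : SO N) :
    P U := by
  suffices h : ∀ d k : ℕ, k + d = N → ∀ U : SO N,
      (∀ r c : Fin N, (c : ℕ) < k → U.1 r c = (1 : Matrix (Fin N) (Fin N) ℝ) r c) → P U from
    h N 0 (zero_add N) U fun _ _ h => absurd h (Nat.not_lt_zero _)
  intro d
  induction d with
  | zero =>
    intro k hk U hU
    have : U = 1 := Subtype.ext (Matrix.ext fun r c => hU r c (by omega))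
    rw [this]
    exact hone
  | succ d ih =>
    intro k hk U hU
    have hkN : k < N := by omega
    refine induction_on_planeRot_column hmul hrot (k := ⟨k, hkN⟩) (fun V hV => ?_) d (k + 1)
      (Nat.lt_succ_self k) (by omega) U (fun r c hc => hU r c hc) (fun r hr hrk => ?_)
      fun h => absurd h (lt_irrefl _)
    · exact ih (k + 1) (by omega) V fun r c hc => hV r c (Fin.le_def.2 (by simp only; omega))
    · have := Fin.lt_def.1 hr
      simp only at this
      omega

/-! ### Oscillation of functions with small tangential gradient -/

lemma rot_sub_one (i j : Fin N) (a b : ℝ) :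
    rot i j a b - 1 = b • gen i j + (1 - a) • (gen i j * gen i j) := by
  rw [rot]
  abel

lemma IsGradient.abs_sub_planeRot_le {g : Matrix (Fin N) (Fin N) ℝ → ℝ}
    {D : Matrix (Fin N) (Fin N) ℝ → Matrix (Fin N) (Fin N) ℝ} {L K l : ℝ}
    (hg : IsGradient g D L K l) (x : SO N) (i j : Fin N) {u : ℝ} (hu : |u| ≤ 1) :
    |g (x * planeRot i j u).1 - g x.1| ≤ 2 * l * |u| + (2 * L + 16 * K) * u ^ 2 := by
  set E := gen i j with hE
  have c1 : |1 - Real.cos u| ≤ u ^ 2 / 2 := by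
    rw [abs_of_nonneg (by linarith [Real.cos_le_one u])]
    linarith [Real.one_sub_sq_div_two_le_cos (x := u)]
  have s1 : |Real.sin u| ≤ |u| := Real.abs_sin_le_abs
  have hE1 : hs E ≤ 2 := hs_gen_le i j
  have hE2 : hs (E * E) ≤ 4 := (hs_mul_le E E).trans (by nlinarith [hs_nonneg E])
  have e : (x * planeRot i j u).1 = x.1 + x.1 * ((planeRot i j u).1 - 1) := by
    change x.1 * (planeRot i j u).1 = _
    rw [mul_sub, mul_one]
    abel
  have e2 : (planeRot i j u).1 - 1 = Real.sin u • E + (1 - Real.cos u) • (E * E) :=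
    rot_sub_one i j _ _
  have hu2 : u ^ 2 = |u| ^ 2 := (sq_abs u).symm
  have hu0 := abs_nonneg u
  have b1 : hs (x.1 * ((planeRot i j u).1 - 1)) ≤ 4 * |u| := by
    rw [hs_orth_mul _ _ (SO_transpose_mul x), e2]
    refine (hs_add_le _ _).trans ?_
    rw [hs_smul, hs_smul]
    have := mul_le_mul s1 hE1 (hs_nonneg _) hu0
    have := mul_le_mul c1 hE2 (hs_nonneg _) (by positivity)
    nlinarith
  have T := hg.taylor x.1 (x.1 * ((planeRot i j u).1 - 1))
  have b2 : K * ip (x.1 * ((planeRot i j u).1 - 1)) (x.1 * ((planeRot i j u).1 - 1)) ≤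
      K * (16 * u ^ 2) := by
    refine mul_le_mul_of_nonneg_left ?_ hg.K_nonneg
    rw [← hs_sq]
    nlinarith [hs_nonneg (x.1 * ((planeRot i j u).1 - 1))]
  have b3 : |ip (D x.1) (x.1 * ((planeRot i j u).1 - 1))| ≤ 2 * l * |u| + 2 * L * u ^ 2 := by
    rw [e2, mul_add, ip_add_right, mul_smul_comm, mul_smul_comm, ip_smul_right, ip_smul_right]
    refine (abs_add_le _ _).trans ?_
    rw [abs_mul, abs_mul]
    have t1 : |ip (D x.1) (x.1 * E)| ≤ l * 2 :=
      (hg.tang x E (gen_transpose i j)).trans (mul_le_mul_of_nonneg_left hE1 hg.l_nonneg)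
    have t2 : |ip (D x.1) (x.1 * (E * E))| ≤ L * 4 := by
      refine (hg.lip _ _).trans (mul_le_mul_of_nonneg_left ?_ hg.L_nonneg)
      rwa [hs_orth_mul _ _ (SO_transpose_mul x)]
    have := mul_le_mul s1 t1 (abs_nonneg _) hu0
    have := mul_le_mul c1 t2 (abs_nonneg _) (by positivity)
    linarith
  rw [e]
  rw [abs_le] at T b3 ⊢
  constructor <;> linarith [T.1, T.2, b3.1, b3.2]

lemma IsGradient.abs_sub_planeRot_le_mul {g : Matrix (Fin N) (Fin N) ℝ → ℝ}
    {D : Matrix (Fin N) (Fin N) ℝ → Matrix (Fin N) (Fin N) ℝ} {L K l : ℝ}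
    (hg : IsGradient g D L K l) (x : SO N) (i j : Fin N) (θ : ℝ) :
    |g (x * planeRot i j θ).1 - g x.1| ≤ 2 * |θ| * l := by
  have hmul : ∀ (u : ℝ), |u| ≤ 1 → ∀ k : ℕ, |g (x * planeRot i j (k * u)).1 - g x.1| ≤
      k * (2 * l * |u| + (2 * L + 16 * K) * u ^ 2) := by
    intro u hu k
    induction k with
    | zero => simp [planeRot_zero]
    | succ k ih =>
      have h := hg.abs_sub_planeRot_le (x * planeRot i j (k * u)) i j hu
      rw [mul_assoc, planeRot_mul, ← add_one_mul] at h
      rw [Nat.cast_add_one]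
      have := abs_sub_le (g (x * planeRot i j ((k + 1) * u)).1) (g (x * planeRot i j (k * u)).1)
        (g x.1)
      linarith
  have hlim : Filter.Tendsto (fun n : ℕ => 2 * |θ| * l + (2 * L + 16 * K) * θ ^ 2 / (n : ℝ))
      Filter.atTop (nhds (2 * |θ| * l + 0)) :=
    tendsto_const_nhds.add (tendsto_const_div_atTop_nhds_zero_nat _)
  rw [add_zero] at hlim
  refine ge_of_tendsto hlim ?_
  obtain ⟨n0, hn0⟩ := exists_nat_ge |θ|
  filter_upwards [Filter.eventually_ge_atTop (n0 + 1)] with n hn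
  have hn' : (n0 : ℝ) + 1 ≤ n := by exact_mod_cast hn
  have hpos : (0 : ℝ) < n := by
    have : (0 : ℝ) ≤ n0 := Nat.cast_nonneg _
    linarith
  have h := hmul (θ / n) (by
    rw [abs_div, abs_of_pos hpos, div_le_one hpos]
    linarith) n
  rw [mul_div_cancel₀ _ hpos.ne', abs_div, abs_of_pos hpos] at h
  refine h.trans (le_of_eq ?_)
  field_simp

/-- Translates of functions with tangential gradient of size `l` vary by at most `C * l`. -/
theorem exists_oscillation_bound (y : SO N) : ∃ C : ℝ, ∀ (g : Matrix (Fin N) (Fin N) ℝ → ℝ)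
    (D : Matrix (Fin N) (Fin N) ℝ → Matrix (Fin N) (Fin N) ℝ) (L K l : ℝ),
    IsGradient g D L K l → ∀ x : SO N, |g (x * y).1 - g x.1| ≤ C * l := by
  refine induction_on_planeRot (P := fun y => ∃ C : ℝ, ∀ (g : Matrix (Fin N) (Fin N) ℝ → ℝ)
    (D : Matrix (Fin N) (Fin N) ℝ → Matrix (Fin N) (Fin N) ℝ) (L K l : ℝ),
    IsGradient g D L K l → ∀ x : SO N, |g (x * y).1 - g x.1| ≤ C * l)
    ⟨0, fun g D L K l _ x => by simp⟩ ?_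
    (fun i j θ => ⟨2 * |θ|, fun g D L K l hg x => hg.abs_sub_planeRot_le_mul x i j θ⟩) y
  rintro U V ⟨C, hC⟩ ⟨C', hC'⟩
  refine ⟨C + C', fun g D L K l hg x => ?_⟩
  have h1 := hC g D L K l hg x
  have h2 := hC' g D L K l hg (x * U)
  rw [mul_assoc] at h2
  have := abs_sub_le (g (x * (U * V)).1) (g (x * U).1) (g x.1)
  linarith

/-! ### The covariance inequality -/

lemma integral_dirichlet_form (μ : Measure (SO N)) [IsProbabilityMeasure μ]
    [μ.IsMulRightInvariant] {ν : Measure (SO N)} {s : ℝ} (hν : IsStep ν s) {u v : SO N → ℝ}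
    (hu : Continuous u) (hv : Continuous v) :
    ∫ x, (u x - ∫ q, u (x * q) ∂ν) * v x ∂μ =
      1 / 2 * ∫ x, ∫ q, (u (x * q) - u x) * (v (x * q) - v x) ∂ν ∂μ := by
  have := hν.prob
  have i1 : ∫ x, ∫ q, u (x * q) * v (x * q) ∂ν ∂μ = ∫ x, u x * v x ∂μ := by
    rw [integral_integral_swap (integrable_SO_prod μ ν (by fun_prop))]
    have : ∀ q : SO N, ∫ x, u (x * q) * v (x * q) ∂μ = ∫ x, u x * v x ∂μ := fun q =>
      integral_mul_right_eq_self (fun x => u x * v x) q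
    simp [this]
  have i2 : ∫ x, ∫ q, u x * v (x * q) ∂ν ∂μ = ∫ x, ∫ q, u (x * q) * v x ∂ν ∂μ := by
    rw [integral_integral_swap (integrable_SO_prod μ ν (by fun_prop)),
      integral_integral_swap (integrable_SO_prod μ ν (by fun_prop))]
    have e : ∀ q : SO N, ∫ x, u x * v (x * q) ∂μ = ∫ x, u (x * q⁻¹) * v x ∂μ := fun q => by
      rw [← integral_mul_right_eq_self (fun x => u (x * q⁻¹) * v x) q]
      simp
    simp only [e]
    conv_rhs => rw [← hν.inv]
    rw [integral_map (φ := fun q : SO N => q⁻¹) (f := fun q : SO N => ∫ x, u (x * q) * v x ∂μ)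
      continuous_inv.aemeasurable]
    exact (continuous_integral_SO μ (by fun_prop)).aestronglyMeasurable
  have c1 : Continuous fun x => ∫ q, u (x * q) * v (x * q) ∂ν :=
    continuous_integral_SO ν (by fun_prop)
  have c2 : Continuous fun x => ∫ q, u x * v (x * q) ∂ν := continuous_integral_SO ν (by fun_prop)
  have c3 : Continuous fun x => ∫ q, u (x * q) * v x ∂ν := continuous_integral_SO ν (by fun_prop)
  have e1 : ∀ x, ∫ q, (u (x * q) - u x) * (v (x * q) - v x) ∂ν =
      ∫ q, u (x * q) * v (x * q) ∂ν - ∫ q, u x * v (x * q) ∂ν - ∫ q, u (x * q) * v x ∂ν +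
        u x * v x := fun x => by
    rw [← integral_sub (integrable_SO ν (by fun_prop)) (integrable_SO ν (by fun_prop)),
      ← integral_sub (integrable_SO ν (by fun_prop)) (integrable_SO ν (by fun_prop))]
    have : u x * v x = ∫ _ : SO N, u x * v x ∂ν := by simp
    rw [this, ← integral_add (integrable_SO ν (by fun_prop)) (integrable_const _)]
    congr 1
    funext q
    ring
  have e2 : ∀ x, (u x - ∫ q, u (x * q) ∂ν) * v x = u x * v x - ∫ q, u (x * q) * v x ∂ν :=
    fun x => by rw [integral_mul_const, sub_mul]
  simp only [e1, e2]
  rw [integral_add (integrable_SO μ (by fun_prop)) (integrable_SO μ (by fun_prop)),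
    integral_sub (integrable_SO μ (by fun_prop)) (integrable_SO μ c3),
    integral_sub (integrable_SO μ (by fun_prop)) (integrable_SO μ (by fun_prop)),
    integral_sub (integrable_SO μ (by fun_prop)) (integrable_SO μ (by fun_prop)), i1, i2]
  ring

lemma IsGradient.abs_increment_sub_le {g : Matrix (Fin N) (Fin N) ℝ → ℝ}
    {D : Matrix (Fin N) (Fin N) ℝ → Matrix (Fin N) (Fin N) ℝ} {L K l s : ℝ}
    (hg : IsGradient g D L K l) (h0 : 0 ≤ s) (h1 : s ≤ 1) (x q : SO N)
    (hnear : hs (q.1 - 1 - skewPart q.1) ≤ 4 * s ^ 2) (hsmall : hs (skewPart q.1) ≤ 2 * s) :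
    |g (x * q).1 - g x.1 - ip (D x.1) (x.1 * skewPart q.1)| ≤ (36 * K + 4 * L) * s ^ 2 := by
  have e : (x * q).1 = x.1 + x.1 * (q.1 - 1) := by
    change x.1 * q.1 = _
    rw [mul_sub, mul_one]
    abel
  have e2 : x.1 * (q.1 - 1) = x.1 * skewPart q.1 + x.1 * (q.1 - 1 - skewPart q.1) := by
    rw [← mul_add]
    congr 1
    abel
  have b1 : hs (x.1 * (q.1 - 1)) ≤ 6 * s := by
    rw [e2]
    refine (hs_add_le _ _).trans ?_
    rw [hs_orth_mul _ _ (SO_transpose_mul x), hs_orth_mul _ _ (SO_transpose_mul x)]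
    nlinarith
  have T := hg.taylor x.1 (x.1 * (q.1 - 1))
  have b2 : K * ip (x.1 * (q.1 - 1)) (x.1 * (q.1 - 1)) ≤ K * (36 * s ^ 2) := by
    refine mul_le_mul_of_nonneg_left ?_ hg.K_nonneg
    rw [← hs_sq]
    nlinarith [hs_nonneg (x.1 * (q.1 - 1))]
  have b3 : |ip (D x.1) (x.1 * (q.1 - 1 - skewPart q.1))| ≤ L * (4 * s ^ 2) := by
    refine (hg.lip _ _).trans (mul_le_mul_of_nonneg_left ?_ hg.L_nonneg)
    rwa [hs_orth_mul _ _ (SO_transpose_mul x)]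
  have e3 : ip (D x.1) (x.1 * (q.1 - 1)) = ip (D x.1) (x.1 * skewPart q.1) +
      ip (D x.1) (x.1 * (q.1 - 1 - skewPart q.1)) := by rw [← ip_add_right, ← e2]
  rw [e]
  rw [abs_le] at T b3 ⊢
  constructor <;> linarith [T.1, T.2, b3.1, b3.2]

lemma IsGradient.integral_sq_le {ν : Measure (SO N)} {s : ℝ} (hν : IsStep ν s)
    {g : Matrix (Fin N) (Fin N) ℝ → ℝ}
    {D : Matrix (Fin N) (Fin N) ℝ → Matrix (Fin N) (Fin N) ℝ} {L K l : ℝ}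
    (hg : IsGradient g D L K l) (x : SO N) :
    ∫ q : SO N, ip (D x.1) (x.1 * skewPart q.1) ^ 2 ∂ν ≤ 4 * s ^ 2 * l ^ 2 / N ^ 2 := by
  have := hν.grad (x.1ᵀ * D x.1) l fun A hA => by
    rw [← ip_mul_left]
    exact hg.tang x A hA
  simpa only [← ip_mul_left] using this

/-- The constant in the error term of `IsGradient.integral_increment_le`. -/
def incrementConst (L K W K' : ℝ) : ℝ :=
  4 * L * W * (36 * K + 4 * L) + 2 * L * K' * (38 * (K + L)) ^ 2 + (36 * K + 4 * L) ^ 2 * W +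
    (36 * K + 4 * L) * K' * (38 * (K + L)) ^ 2

lemma mul_increment_le {a b A B c w W K' L s d : ℝ} (hs0 : 0 ≤ s) (hs1 : s ≤ 1)
    (hL : 0 ≤ L) (hw : 0 ≤ w) (hwW : w ≤ W) (hK' : 0 ≤ K') (hc : 0 ≤ c) (hd : 2 * L + c ≤ d)
    (hA : |A - a| ≤ c * s ^ 2) (hB : |B - b| ≤ c * s ^ 2) (ha : |a| ≤ 2 * L * s)
    (hb : |b| ≤ 2 * L * s) :
    |A| * (w * |B| + K' * B ^ 2) ≤ w * (|a| * |b|) +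
      (4 * L * W * c + 2 * L * K' * d ^ 2 + c ^ 2 * W + c * K' * d ^ 2) * s ^ 3 := by
  have hs2 : 0 ≤ s ^ 2 := sq_nonneg s
  have hA' : |A| ≤ |a| + c * s ^ 2 := by
    have := abs_add_le a (A - a)
    rw [add_sub_cancel] at this
    linarith
  have hB' : |B| ≤ |b| + c * s ^ 2 := by
    have := abs_add_le b (B - b)
    rw [add_sub_cancel] at this
    linarith
  have hd0 : 0 ≤ d := by linarith
  have hBd : |B| ≤ d * s := by
    have e1 : c * s ^ 2 ≤ c * s := mul_le_mul_of_nonneg_left (by nlinarith) hc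
    have e2 : (2 * L + c) * s ≤ d * s := mul_le_mul_of_nonneg_right hd hs0
    linarith
  have hB2 : B ^ 2 ≤ d ^ 2 * s ^ 2 := by
    rw [← sq_abs, ← mul_pow]
    exact pow_le_pow_left₀ (abs_nonneg _) hBd 2
  have h1 : w * |B| + K' * B ^ 2 ≤ w * |b| + (W * c + K' * d ^ 2) * s ^ 2 := by
    have e1 : w * |B| ≤ w * (|b| + c * s ^ 2) := mul_le_mul_of_nonneg_left hB' hw
    have e2 : K' * B ^ 2 ≤ K' * (d ^ 2 * s ^ 2) := mul_le_mul_of_nonneg_left hB2 hK'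
    have e3 : w * (c * s ^ 2) ≤ W * (c * s ^ 2) := mul_le_mul_of_nonneg_right hwW (by positivity)
    linarith
  have hW : 0 ≤ W := hw.trans hwW
  have h2 : 0 ≤ w * |B| + K' * B ^ 2 := by positivity
  have hE : 0 ≤ W * c + K' * d ^ 2 := by positivity
  calc |A| * (w * |B| + K' * B ^ 2)
      ≤ (|a| + c * s ^ 2) * (w * |b| + (W * c + K' * d ^ 2) * s ^ 2) :=
        mul_le_mul hA' h1 h2 (by positivity)
    _ = w * (|a| * |b|) + |a| * ((W * c + K' * d ^ 2) * s ^ 2) + c * s ^ 2 * (w * |b|) +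
        c * (W * c + K' * d ^ 2) * (s ^ 3 * s) := by ring
    _ ≤ w * (|a| * |b|) + 2 * L * s * ((W * c + K' * d ^ 2) * s ^ 2) +
        c * s ^ 2 * (W * (2 * L * s)) + c * (W * c + K' * d ^ 2) * (s ^ 3 * 1) := by
      gcongr
    _ = _ := by ring

lemma IsGradient.integral_increment_le {ν : Measure (SO N)} {s : ℝ} (hν : IsStep ν s)
    (h0 : 0 ≤ s) (h1 : s ≤ 1) {g g' : Matrix (Fin N) (Fin N) ℝ → ℝ}
    {D D' : Matrix (Fin N) (Fin N) ℝ → Matrix (Fin N) (Fin N) ℝ} {L K l r : ℝ} (hr : 0 < r)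
    (hg : IsGradient g D L K l) (hg' : IsGradient g' D' L K (r * l)) {w G : SO N → ℝ}
    {W K' : ℝ} (hG : Continuous G) (hw : ∀ x, 0 ≤ w x) (hwW : ∀ x, w x ≤ W) (hK' : 0 ≤ K')
    (hwG : ∀ x y : SO N, |G y - G x| ≤ w x * |g y.1 - g x.1| + K' * (g y.1 - g x.1) ^ 2)
    (x : SO N) :
    ∫ q, (g' (x * q).1 - g' x.1) * (G (x * q) - G x) ∂ν ≤
      w x * (4 * s ^ 2 * r * l ^ 2 / N ^ 2) + incrementConst L K W K' * s ^ 3 := by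
  have := hν.prob
  have hgc := hg.cont
  have hgc' := hg'.cont
  have hL := hg.L_nonneg
  have hK := hg.K_nonneg
  have hpt : ∀ᵐ q ∂ν, (g' (x * q).1 - g' x.1) * (G (x * q) - G x) ≤
      w x * (1 / 2 * (r⁻¹ * ip (D' x.1) (x.1 * skewPart q.1) ^ 2 +
        r * ip (D x.1) (x.1 * skewPart q.1) ^ 2)) + incrementConst L K W K' * s ^ 3 := by
    filter_upwards [hν.near, hν.small] with q hq1 hq2
    have hx : hs (x.1 * skewPart q.1) ≤ 2 * s := by
      rwa [hs_orth_mul _ _ (SO_transpose_mul x)]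
    have ha : |ip (D' x.1) (x.1 * skewPart q.1)| ≤ 2 * L * s :=
      (hg'.lip _ _).trans (by nlinarith)
    have hb : |ip (D x.1) (x.1 * skewPart q.1)| ≤ 2 * L * s :=
      (hg.lip _ _).trans (by nlinarith)
    have hA := hg'.abs_increment_sub_le h0 h1 x q hq1 hq2
    have hB := hg.abs_increment_sub_le h0 h1 x q hq1 hq2
    have key := mul_increment_le h0 h1 hL (hw x) (hwW x) hK' (by positivity)
      (show 2 * L + (36 * K + 4 * L) ≤ 38 * (K + L) by linarith) hA hB ha hb
    refine (le_abs_self _).trans ?_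
    rw [abs_mul]
    refine (mul_le_mul_of_nonneg_left (hwG x (x * q)) (abs_nonneg _)).trans (key.trans ?_)
    unfold incrementConst
    refine add_le_add_left (mul_le_mul_of_nonneg_left ?_ (hw x)) _
    set a := ip (D' x.1) (x.1 * skewPart q.1)
    set b := ip (D x.1) (x.1 * skewPart q.1)
    have e1 : r⁻¹ * a ^ 2 + r * b ^ 2 - 2 * (|a| * |b|) = r⁻¹ * (|a| - r * |b|) ^ 2 := by
      rw [← sq_abs a, ← sq_abs b]
      field_simp
      ring
    have e2 : 0 ≤ r⁻¹ * (|a| - r * |b|) ^ 2 := by positivity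
    linarith
  refine (integral_mono_ae (integrable_SO ν (by fun_prop)) (integrable_SO ν (by fun_prop))
    hpt).trans ?_
  rw [integral_add (integrable_SO ν (by fun_prop)) (integrable_const _), integral_const_mul,
    integral_const_mul, integral_add (integrable_SO ν (by fun_prop))
    (integrable_SO ν (by fun_prop)), integral_const_mul, integral_const_mul, integral_const]
  simp only [probReal_univ, smul_eq_mul, one_mul]
  refine add_le_add_left (mul_le_mul_of_nonneg_left ?_ (hw x)) _
  have j1 := mul_le_mul_of_nonneg_left (hg'.integral_sq_le hν x) (inv_pos.2 hr).le
  have j2 := mul_le_mul_of_nonneg_left (hg.integral_sq_le hν x) hr.le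
  have e : r⁻¹ * (4 * s ^ 2 * (r * l) ^ 2 / N ^ 2) = r * (4 * s ^ 2 * l ^ 2 / N ^ 2) := by
    field_simp
  rw [e] at j1
  refine (mul_le_mul_of_nonneg_left (add_le_add j1 j2) (by norm_num)).trans (le_of_eq ?_)
  ring

lemma IsGradient.iterate {ν : Measure (SO N)} {s : ℝ} (hν : IsStep ν s)
    {g : Matrix (Fin N) (Fin N) ℝ → ℝ}
    {D : Matrix (Fin N) (Fin N) ℝ → Matrix (Fin N) (Fin N) ℝ} {L K l : ℝ}
    (hg : IsGradient g D L K l) {ρ : ℝ} (hρ : 0 ≤ ρ)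
    (hρ2 : 1 - s ^ 2 * ((N : ℝ) - 2) / N ^ 2 ≤ ρ ^ 2) (k : ℕ) :
    IsGradient ((avg ν)^[k] g) ((avgGrad ν)^[k] D) L K (ρ ^ k * l) := by
  induction k with
  | zero => simpa using hg
  | succ k ih =>
    rw [Function.iterate_succ_apply', Function.iterate_succ_apply', pow_succ', mul_assoc]
    exact ih.average hν hρ hρ2

lemma integral_avg (μ : Measure (SO N)) [IsProbabilityMeasure μ] [μ.IsMulRightInvariant]
    (ν : Measure (SO N)) [IsProbabilityMeasure ν] {g : Matrix (Fin N) (Fin N) ℝ → ℝ}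
    (hg : Continuous g) : ∫ x : SO N, avg ν g x.1 ∂μ = ∫ x : SO N, g x.1 ∂μ := by
  unfold avg
  rw [integral_integral_swap (integrable_SO_prod μ ν (by fun_prop))]
  have : ∀ q : SO N, ∫ x : SO N, g (x.1 * q.1) ∂μ = ∫ x : SO N, g x.1 ∂μ := fun q =>
    integral_mul_right_eq_self (fun x : SO N => g x.1) q
  simp [this]

lemma continuous_avg (ν : Measure (SO N)) [IsProbabilityMeasure ν]
    {g : Matrix (Fin N) (Fin N) ℝ → ℝ} (hg : Continuous g) : Continuous (avg ν g) :=
  continuous_integral_SO ν (by fun_prop)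

lemma continuous_iterate_avg (ν : Measure (SO N)) [IsProbabilityMeasure ν]
    {g : Matrix (Fin N) (Fin N) ℝ → ℝ} (hg : Continuous g) (k : ℕ) :
    Continuous ((avg ν)^[k] g) := by
  induction k with
  | zero => exact hg
  | succ k ih =>
    rw [Function.iterate_succ_apply']
    exact continuous_avg ν ih

lemma integral_iterate_avg (μ : Measure (SO N)) [IsProbabilityMeasure μ] [μ.IsMulRightInvariant]
    (ν : Measure (SO N)) [IsProbabilityMeasure ν] {g : Matrix (Fin N) (Fin N) ℝ → ℝ}
    (hg : Continuous g) (k : ℕ) :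
    ∫ x : SO N, (avg ν)^[k] g x.1 ∂μ = ∫ x : SO N, g x.1 ∂μ := by
  induction k with
  | zero => rfl
  | succ k ih =>
    rw [Function.iterate_succ_apply', integral_avg μ ν (continuous_iterate_avg ν hg k), ih]

lemma abs_iterate_avg_le (ν : Measure (SO N)) [IsProbabilityMeasure ν]
    {g : Matrix (Fin N) (Fin N) ℝ → ℝ} {B : ℝ} (hg : ∀ x : SO N, |g x.1| ≤ B) (k : ℕ) (x : SO N) :
    |(avg ν)^[k] g x.1| ≤ B := by
  induction k generalizing x with
  | zero => exact hg x
  | succ k ih =>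
    rw [Function.iterate_succ_apply']
    exact abs_integral_le_of_forall ν fun q => ih (x * q)

lemma IsGradient.integral_sub_iterate_mul_le (μ : Measure (SO N)) [IsProbabilityMeasure μ]
    [μ.IsMulRightInvariant] {ν : Measure (SO N)} {s : ℝ} (hν : IsStep ν s)
    (h0 : 0 ≤ s) (h1 : s ≤ 1) {g : Matrix (Fin N) (Fin N) ℝ → ℝ}
    {D : Matrix (Fin N) (Fin N) ℝ → Matrix (Fin N) (Fin N) ℝ} {L K l ρ : ℝ} (hρ : 0 < ρ)
    (hρ2 : 1 - s ^ 2 * ((N : ℝ) - 2) / N ^ 2 ≤ ρ ^ 2)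
    (hg : IsGradient g D L K l) {w G : SO N → ℝ}
    {W K' : ℝ} (hG : Continuous G) (hwc : Continuous w) (hw : ∀ x, 0 ≤ w x) (hwW : ∀ x, w x ≤ W)
    (hK' : 0 ≤ K')
    (hwG : ∀ x y : SO N, |G y - G x| ≤ w x * |g y.1 - g x.1| + K' * (g y.1 - g x.1) ^ 2) (n : ℕ) :
    ∫ x : SO N, (g x.1 - (avg ν)^[n] g x.1) * G x ∂μ ≤
      (2 * s ^ 2 * l ^ 2 / N ^ 2 * ∫ x, w x ∂μ) * ∑ k ∈ Finset.range n, ρ ^ k +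
        n * (incrementConst L K W K' * s ^ 3 / 2) := by
  have := hν.prob
  have hgc := hg.cont
  induction n with
  | zero => simp
  | succ n ih =>
    have hn := hg.iterate hν hρ.le hρ2 n
    have hnc := hn.cont
    have hnc' := continuous_iterate_avg ν hgc (n + 1)
    have hstep : ∫ x : SO N, ((avg ν)^[n] g x.1 - (avg ν)^[n + 1] g x.1) * G x ∂μ ≤
        (2 * s ^ 2 * l ^ 2 / N ^ 2 * ∫ x, w x ∂μ) * ρ ^ n +
          incrementConst L K W K' * s ^ 3 / 2 := by
      simp only [Function.iterate_succ_apply']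
      have e := integral_dirichlet_form μ hν (u := fun x : SO N => (avg ν)^[n] g x.1) (v := G)
        (by fun_prop) hG
      refine e.le.trans ?_
      have hi := integral_mono (μ := μ)
        (f := fun x => ∫ q, ((avg ν)^[n] g (x * q).1 - (avg ν)^[n] g x.1) * (G (x * q) - G x) ∂ν)
        (integrable_SO μ (continuous_integral_SO ν (by fun_prop)))
        (integrable_SO μ (by fun_prop))
        (hg.integral_increment_le hν h0 h1 (pow_pos hρ n) hn hG hw hwW hK' hwG)
      refine (mul_le_mul_of_nonneg_left hi (by norm_num)).trans (le_of_eq ?_)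
      rw [integral_add (integrable_SO μ (by fun_prop)) (integrable_const _), integral_mul_const,
        integral_const]
      simp only [probReal_univ, smul_eq_mul, one_mul]
      ring
    have hsplit : ∫ x : SO N, (g x.1 - (avg ν)^[n + 1] g x.1) * G x ∂μ =
        ∫ x : SO N, (g x.1 - (avg ν)^[n] g x.1) * G x ∂μ +
          ∫ x : SO N, ((avg ν)^[n] g x.1 - (avg ν)^[n + 1] g x.1) * G x ∂μ := by
      rw [← integral_add (integrable_SO μ (by fun_prop)) (integrable_SO μ (by fun_prop))]
      congr 1
      funext x
      ring
    rw [hsplit, Finset.sum_range_succ, Nat.cast_add_one]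
    linarith

lemma one_sub_exp_neg_ge {t : ℝ} (h0 : 0 ≤ t) (h1 : t ≤ 1) : t / 2 ≤ 1 - Real.exp (-t) := by
  have h2 := Real.add_one_le_exp t
  have h3 : Real.exp (-t) * Real.exp t = 1 := by rw [← Real.exp_add]; simp
  have h4 := Real.exp_pos (-t)
  nlinarith

lemma geom_sum_exp_le {t : ℝ} (h0 : 0 < t) (h1 : t ≤ 1) (n : ℕ) :
    ∑ k ∈ Finset.range n, Real.exp (-t) ^ k ≤ 2 / t := by
  have h2 := one_sub_exp_neg_ge h0.le h1
  have h3 := mul_neg_geom_sum (Real.exp (-t)) n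
  have h4 : 0 < Real.exp (-t) ^ n := by positivity
  have h5 : 0 ≤ ∑ k ∈ Finset.range n, Real.exp (-t) ^ k :=
    Finset.sum_nonneg fun _ _ => by positivity
  rw [le_div_iff₀ h0]
  nlinarith

lemma tendsto_integral_sub_mul (μ : Measure (SO N)) [IsProbabilityMeasure μ]
    [μ.IsMulLeftInvariant] {u : ℕ → SO N → ℝ} (hu : ∀ n, Continuous (u n)) {B c : ℝ}
    (hB : ∀ n x, |u n x| ≤ B) (hc : ∀ n, ∫ x, u n x ∂μ = c)
    (hosc : ∀ x y, Filter.Tendsto (fun n => u n (x * y) - u n x) Filter.atTop (nhds 0))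
    {G : SO N → ℝ} (hG : Continuous G) :
    Filter.Tendsto (fun n => ∫ x, (u n x - c) * G x ∂μ) Filter.atTop (nhds 0) := by
  have h1 : ∀ x, Filter.Tendsto (fun n => u n x - c) Filter.atTop (nhds 0) := fun x => by
    have e : ∀ n, u n x - c = -∫ y, (u n (x * y) - u n x) ∂μ := fun n => by
      have := hu n
      rw [integral_sub (integrable_SO μ (by fun_prop)) (integrable_const _),
        integral_mul_left_eq_self (u n) x, hc]
      simp
    simp only [e]
    have := tendsto_integral_of_dominated_convergence (μ := μ) (f := fun _ => (0 : ℝ))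
      (F := fun n y => u n (x * y) - u n x) (fun _ => 2 * B)
      (fun n => Continuous.aestronglyMeasurable (by have := hu n; fun_prop)) (integrable_const _)
      (fun n => ae_of_all _ fun y => by
        rw [Real.norm_eq_abs]
        refine (abs_sub _ _).trans ?_
        linarith [hB n (x * y), hB n x])
      (ae_of_all _ fun y => hosc x y)
    simpa using this.neg
  have := tendsto_integral_of_dominated_convergence (μ := μ) (f := fun _ => (0 : ℝ))
    (F := fun n x => (u n x - c) * G x) (fun x => (B + |c|) * |G x|)
    (fun n => Continuous.aestronglyMeasurable (by have := hu n; fun_prop))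
    (integrable_SO μ (by fun_prop))
    (fun n => ae_of_all _ fun x => by
      rw [Real.norm_eq_abs, abs_mul]
      refine mul_le_mul_of_nonneg_right ((abs_sub _ _).trans ?_) (abs_nonneg _)
      linarith [hB n x])
    (ae_of_all _ fun x => by simpa using (h1 x).mul_const (G x))
  simpa using this

lemma exists_abs_le_of_continuous {f : SO N → ℝ} (hf : Continuous f) : ∃ B, ∀ x, |f x| ≤ B := by
  obtain ⟨B, hB⟩ := isCompact_univ.exists_bound_of_continuousOn hf.continuousOn
  exact ⟨B, fun x => hB x (mem_univ x)⟩

/-- The covariance of a function `g` of gradient at most `L` with a function of `g` is controlled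
by the mean slope of the latter. -/
theorem IsGradient.covariance_le (hN : 3 ≤ N) (μ : Measure (SO N)) [IsProbabilityMeasure μ]
    [μ.IsMulLeftInvariant] {g : Matrix (Fin N) (Fin N) ℝ → ℝ}
    {D : Matrix (Fin N) (Fin N) ℝ → Matrix (Fin N) (Fin N) ℝ} {L K l : ℝ}
    (hg : IsGradient g D L K l) {w G : SO N → ℝ} {K' : ℝ} (hG : Continuous G)
    (hwc : Continuous w) (hw : ∀ x, 0 ≤ w x) (hK' : 0 ≤ K')
    (hwG : ∀ x y : SO N, |G y - G x| ≤ w x * |g y.1 - g x.1| + K' * (g y.1 - g x.1) ^ 2) :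
    ∫ x : SO N, (g x.1 - ∫ y : SO N, g y.1 ∂μ) * G x ∂μ ≤ 24 * l ^ 2 / N * ∫ x, w x ∂μ := by
  have hgc := hg.cont
  have hN' : (3 : ℝ) ≤ N := by exact_mod_cast hN
  have hN0 : (0 : ℝ) < N := by linarith
  obtain ⟨W, hW⟩ := exists_abs_le_of_continuous hwc
  obtain ⟨B, hB⟩ := exists_abs_le_of_continuous (f := fun x : SO N => g x.1) (by fun_prop)
  set c := ∫ y : SO N, g y.1 ∂μ with hc
  set s : ℕ → ℝ := fun M => 1 / ((M : ℝ) + 1) ^ 2 with hs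
  have hM : ∀ M : ℕ, (1 : ℝ) ≤ (M : ℝ) + 1 := fun M => by
    have : (0 : ℝ) ≤ M := Nat.cast_nonneg M
    linarith
  have hs0 : ∀ M, 0 < s M := fun M => by have := hM M; simp only [hs]; positivity
  have hs1 : ∀ M, s M ≤ 1 := fun M => by
    simp only [hs]
    rw [div_le_one (by have := hM M; positivity)]
    exact one_le_pow₀ (hM M)
  have hsI : ∀ M, s M ∈ Icc (-1 : ℝ) 1 := fun M => ⟨by linarith [hs0 M], hs1 M⟩
  set ν : ℕ → Measure (SO N) := fun M => stepMeasure μ (s M) (hsI M) with hνdef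
  have hν : ∀ M, IsStep (ν M) (s M) := fun M =>
    isStep_stepMeasure (by omega) μ (s M) (hs0 M).le (hsI M)
  have hνp : ∀ M, IsProbabilityMeasure (ν M) := fun M => (hν M).prob
  set t : ℕ → ℝ := fun M => s M ^ 2 * ((N : ℝ) - 2) / N ^ 2 / 2 with ht
  have ht0 : ∀ M, 0 < t M := fun M => by
    have := hs0 M
    have : (0 : ℝ) < N - 2 := by linarith
    simp only [ht]
    positivity
  have ht1 : ∀ M, t M ≤ 1 := fun M => by
    simp only [ht]
    have h1 : s M ^ 2 ≤ 1 := pow_le_one₀ (hs0 M).le (hs1 M)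
    have h2 : s M ^ 2 * ((N : ℝ) - 2) ≤ 1 * N ^ 2 :=
      mul_le_mul h1 (by nlinarith) (by linarith) zero_le_one
    have h3 : s M ^ 2 * ((N : ℝ) - 2) / N ^ 2 ≤ 1 := by
      rw [div_le_one (by positivity)]
      linarith
    linarith
  set n : ℕ → ℕ := fun M => (M + 1) ^ 5 with hn
  have hρ2 : ∀ M, 1 - s M ^ 2 * ((N : ℝ) - 2) / N ^ 2 ≤ Real.exp (-t M) ^ 2 := fun M => by
    rw [← Real.exp_nat_mul]
    have := Real.add_one_le_exp (-(s M ^ 2 * ((N : ℝ) - 2) / N ^ 2))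
    have e : ((2 : ℕ) : ℝ) * -t M = -(s M ^ 2 * ((N : ℝ) - 2) / N ^ 2) := by
      simp only [ht]; push_cast; ring
    rw [e]
    linarith
  set u : ℕ → SO N → ℝ := fun M x => (avg (ν M))^[n M] g x.1 with hu
  have huc : ∀ M, Continuous (u M) := fun M => by
    have := continuous_iterate_avg (ν M) hgc (n M)
    simp only [hu]
    fun_prop
  have hrem : Filter.Tendsto (fun M => ∫ x, (u M x - c) * G x ∂μ) Filter.atTop (nhds 0) := by
    refine tendsto_integral_sub_mul μ huc (B := B)
      (fun M x => abs_iterate_avg_le (ν M) hB (n M) x)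
      (fun M => integral_iterate_avg μ (ν M) hgc (n M)) (fun x y => ?_) hG
    obtain ⟨C, hC⟩ := exists_oscillation_bound y
    have hlim : Filter.Tendsto (fun M : ℕ => C * (Real.exp (-(((M : ℝ) + 1) *
        (((N : ℝ) - 2) / N ^ 2 / 2))) * l)) Filter.atTop (nhds (C * (0 * l))) := by
      refine Filter.Tendsto.const_mul _ (Filter.Tendsto.mul_const _ ?_)
      refine Real.tendsto_exp_neg_atTop_nhds_zero.comp ?_
      refine Filter.Tendsto.atTop_mul_const (by
        have : (0 : ℝ) < N - 2 := by linarith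
        positivity) ?_
      exact Filter.tendsto_atTop_add_const_right _ _ tendsto_natCast_atTop_atTop
    rw [zero_mul, mul_zero] at hlim
    refine squeeze_zero_norm (fun M => ?_) hlim
    have hgr := hg.iterate (hν M) (Real.exp_pos _).le (hρ2 M) (n M)
    have := hC _ _ _ _ _ hgr x
    rw [Real.norm_eq_abs]
    refine this.trans (le_of_eq ?_)
    rw [← Real.exp_nat_mul]
    congr 3
    simp only [hn, ht, hs]
    have := hM M
    push_cast
    field_simp
  have herr : Filter.Tendsto (fun M : ℕ => (n M : ℝ) * (incrementConst L K W K' * s M ^ 3 / 2))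
      Filter.atTop (nhds 0) := by
    have e : ∀ M : ℕ, (n M : ℝ) * (incrementConst L K W K' * s M ^ 3 / 2) =
        incrementConst L K W K' / 2 * (1 / ((M : ℝ) + 1)) := fun M => by
      have := hM M
      simp only [hn, hs]
      push_cast
      field_simp
    simp only [e]
    simpa using (tendsto_one_div_add_atTop_nhds_zero_nat (𝕜 := ℝ)).const_mul
      (incrementConst L K W K' / 2)
  have hlim := (tendsto_const_nhds (x := 24 * l ^ 2 / N * ∫ x, w x ∂μ)).add (herr.add hrem)
  rw [add_zero, add_zero] at hlim
  refine ge_of_tendsto' hlim fun M => ?_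
  have hmain := hg.integral_sub_iterate_mul_le μ (hν M) (hs0 M).le (hs1 M) (Real.exp_pos _)
    (hρ2 M) hG hwc hw (fun x => (le_abs_self _).trans (hW x)) hK' hwG (n M)
  have hw0 : 0 ≤ ∫ x, w x ∂μ := integral_nonneg hw
  have hgeom := geom_sum_exp_le (ht0 M) (ht1 M) (n M)
  have hcoef : (2 * s M ^ 2 * l ^ 2 / N ^ 2 * ∫ x, w x ∂μ) *
      ∑ k ∈ Finset.range (n M), Real.exp (-t M) ^ k ≤ 24 * l ^ 2 / N * ∫ x, w x ∂μ := by
    refine (mul_le_mul_of_nonneg_left hgeom (by positivity)).trans ?_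
    have h2 : (0 : ℝ) < N - 2 := by linarith
    have e : (2 * s M ^ 2 * l ^ 2 / N ^ 2 * ∫ x, w x ∂μ) * (2 / t M) =
        8 * l ^ 2 / (N - 2) * ∫ x, w x ∂μ := by
      have := hs0 M
      simp only [ht]
      field_simp
      ring
    rw [e]
    refine mul_le_mul_of_nonneg_right ?_ hw0
    rw [div_le_div_iff₀ h2 hN0]
    nlinarith [sq_nonneg l]
  have hsplit : ∫ x : SO N, (g x.1 - c) * G x ∂μ =
      ∫ x : SO N, (g x.1 - u M x) * G x ∂μ + ∫ x : SO N, (u M x - c) * G x ∂μ := by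
    have := huc M
    rw [← integral_add (integrable_SO μ (by fun_prop)) (integrable_SO μ (by fun_prop))]
    congr 1
    funext x
    ring
  rw [hsplit]
  linarith

/-! ### From the covariance inequality to concentration -/

/-- The projection of the real line onto `[-ε, ε]`. -/
noncomputable def clip (ε t : ℝ) : ℝ := max (-ε) (min ε t)

lemma abs_clip_le {ε : ℝ} (hε : 0 ≤ ε) (t : ℝ) : |clip ε t| ≤ ε :=
  abs_le.2 ⟨le_max_left _ _, max_le (by linarith) (min_le_left _ _)⟩

lemma abs_clip_sub_le (ε a b : ℝ) : |clip ε b - clip ε a| ≤ |b - a| := by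
  unfold clip
  refine (abs_max_sub_max_le_max _ _ _ _).trans ?_
  rw [sub_self, abs_zero, max_eq_right (abs_nonneg _)]
  refine (abs_min_sub_min_le_max _ _ _ _).trans ?_
  rw [sub_self, abs_zero, max_eq_right (abs_nonneg _)]

lemma clip_mul_nonneg {ε : ℝ} (hε : 0 ≤ ε) (t : ℝ) : 0 ≤ t * clip ε t := by
  unfold clip
  rcases le_total 0 t with h | h
  · exact mul_nonneg h (le_max_of_le_right (le_min hε h))
  · exact mul_nonneg_of_nonpos_of_nonpos h
      (max_le (by linarith) ((min_le_right _ _).trans h))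

lemma mul_clip_of_le_abs {ε t : ℝ} (hε : 0 ≤ ε) (h : ε ≤ |t|) : t * clip ε t = |t| * ε := by
  unfold clip
  rcases le_abs'.1 h with h | h
  · rw [min_eq_right (by linarith), max_eq_left h, abs_of_nonpos (by linarith)]
    ring
  · rw [min_eq_left h, max_eq_right (by linarith), abs_of_nonneg (by linarith)]

lemma abs_clip_of_le_abs {ε t : ℝ} (hε : 0 ≤ ε) (h : ε ≤ |t|) : |clip ε t| = ε := by
  unfold clip
  rcases le_abs'.1 h with h | h
  · rw [min_eq_right (by linarith), max_eq_left h, abs_neg, abs_of_nonneg hε]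
  · rw [min_eq_left h, max_eq_right (by linarith), abs_of_nonneg hε]

lemma continuous_clip (ε : ℝ) : Continuous (clip ε) := by
  unfold clip
  fun_prop

lemma abs_parabola_sub_le {ε p q : ℝ} (hε : 0 < ε) (hp : |p| ≤ ε) :
    |(q - q * |q| / (2 * ε)) - (p - p * |p| / (2 * ε))| ≤
      (1 - |p| / ε) * |q - p| + 1 / ε * (q - p) ^ 2 := by
  have key : |(2 * ε * q - q * |q|) - (2 * ε * p - p * |p|)| ≤
      2 * (ε - |p|) * |q - p| + 2 * (q - p) ^ 2 := by
    rw [abs_le] at hp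
    rcases le_total 0 p with h1 | h1 <;> rcases le_total 0 q with h2 | h2 <;>
      rcases le_total p q with h3 | h3 <;>
      simp only [abs_of_nonneg, abs_of_nonpos, h1, h2, sub_nonneg.2 h3, sub_nonpos.2 h3] <;>
      rw [abs_le] <;> constructor <;> nlinarith
  have e1 : (q - q * |q| / (2 * ε)) - (p - p * |p| / (2 * ε)) =
      ((2 * ε * q - q * |q|) - (2 * ε * p - p * |p|)) / (2 * ε) := by
    field_simp
  have e2 : (1 - |p| / ε) * |q - p| + 1 / ε * (q - p) ^ 2 =
      (2 * (ε - |p|) * |q - p| + 2 * (q - p) ^ 2) / (2 * ε) := by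
    field_simp
  rw [e1, e2, abs_div, abs_of_pos (by positivity : 0 < 2 * ε)]
  gcongr

/-- The covariance inequality tested against a truncated parabola of `X` bounds the tail of `X`. -/
lemma measureReal_le_of_covariance_clip {Ω : Type*} [MeasurableSpace Ω] {μ : Measure Ω}
    [IsProbabilityMeasure μ] {X : Ω → ℝ} (hX : Measurable X) {v ε : ℝ} (hv : 0 ≤ v) (hε : 0 < ε)
    (hint : Integrable (fun x => X x * (clip ε (X x) - clip ε (X x) * |clip ε (X x)| / (2 * ε))) μ)
    (h : ∫ x, X x * (clip ε (X x) - clip ε (X x) * |clip ε (X x)| / (2 * ε)) ∂μ ≤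
      v * ∫ x, (1 - |clip ε (X x)| / ε) ∂μ) :
    ε ^ 2 / 2 * μ.real {x | ε ≤ |X x|} ≤ v * (1 - μ.real {x | ε ≤ |X x|}) := by
  have hS : MeasurableSet {x | ε ≤ |X x|} := measurableSet_le measurable_const hX.abs
  set S := {x | ε ≤ |X x|}
  have h1 : ε ^ 2 / 2 * μ.real S ≤
      ∫ x, X x * (clip ε (X x) - clip ε (X x) * |clip ε (X x)| / (2 * ε)) ∂μ := by
    have : ε ^ 2 / 2 * μ.real S = ∫ x, S.indicator (fun _ => ε ^ 2 / 2) x ∂μ := by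
      rw [integral_indicator hS]
      simp [mul_comm]
    rw [this]
    refine integral_mono ((integrable_const _).indicator hS) hint fun x => ?_
    have e : X x * (clip ε (X x) - clip ε (X x) * |clip ε (X x)| / (2 * ε)) =
        X x * clip ε (X x) * (1 - |clip ε (X x)| / (2 * ε)) := by ring
    by_cases hx : x ∈ S
    · have hx' : ε ≤ |X x| := hx
      simp only [indicator_of_mem hx]
      rw [e, mul_clip_of_le_abs hε.le hx', abs_clip_of_le_abs hε.le hx',
        show 1 - ε / (2 * ε) = 1 / 2 by field_simp; norm_num]
      nlinarith
    · simp only [indicator_of_notMem hx]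
      rw [e]
      refine mul_nonneg (clip_mul_nonneg hε.le _) ?_
      rw [sub_nonneg, div_le_one (by positivity)]
      linarith [abs_clip_le hε.le (X x)]
  have h2 : ∫ x, (1 - |clip ε (X x)| / ε) ∂μ ≤ 1 - μ.real S := by
    rw [← probReal_compl_eq_one_sub hS]
    have : μ.real Sᶜ = ∫ x, Sᶜ.indicator (fun _ => (1 : ℝ)) x ∂μ := by
      rw [integral_indicator hS.compl]
      simp
    rw [this]
    have hm : Measurable fun x => 1 - |clip ε (X x)| / ε :=
      measurable_const.sub ((((continuous_clip ε).measurable.comp hX).abs).div_const _)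
    refine integral_mono ?_ ((integrable_const _).indicator hS.compl) fun x => ?_
    · refine Integrable.of_bound hm.aestronglyMeasurable 1 (ae_of_all _ fun x => ?_)
      have h3 : |clip ε (X x)| / ε ≤ 1 := (div_le_one hε).2 (abs_clip_le hε.le _)
      have h4 : 0 ≤ |clip ε (X x)| / ε := by positivity
      rw [Real.norm_eq_abs, abs_le]
      constructor <;> linarith
    · by_cases hx : x ∈ S
      · have hx' : ε ≤ |X x| := hx
        have hx2 : x ∉ Sᶜ := fun h => h hx
        simp only [indicator_of_notMem hx2, abs_clip_of_le_abs hε.le hx']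
        rw [div_self hε.ne', sub_self]
      · have hx2 : x ∈ Sᶜ := hx
        simp only [indicator_of_mem hx2]
        have h4 : 0 ≤ |clip ε (X x)| / ε := by positivity
        linarith
  exact h1.trans (h.trans (mul_le_mul_of_nonneg_left h2 hv))

/-- The Herbst argument. -/
lemma mgf_le_of_covariance_exp {Ω : Type*} [MeasurableSpace Ω] {μ : Measure Ω}
    [IsProbabilityMeasure μ] {X : Ω → ℝ} (hX : AEMeasurable X μ) {v B : ℝ} (hB : ∀ x, |X x| ≤ B)
    (h : ∀ t : ℝ, 0 ≤ t → ∫ x, X x * Real.exp (t * X x) ∂μ ≤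
      v * t * ∫ x, Real.exp (t * X x) ∂μ) {t : ℝ} (ht : 0 ≤ t) :
    ProbabilityTheory.mgf X μ t ≤ Real.exp (v * t ^ 2 / 2) := by
  have huniv : ProbabilityTheory.integrableExpSet X μ = univ := by
    refine eq_univ_of_forall fun s => ?_
    refine Integrable.of_bound (Real.measurable_exp.comp_aemeasurable
      (hX.const_mul s)).aestronglyMeasurable (Real.exp (|s| * B)) (ae_of_all _ fun x => ?_)
    rw [Real.norm_eq_abs, abs_of_pos (Real.exp_pos _), Real.exp_le_exp]
    refine (le_abs_self _).trans ?_
    rw [abs_mul]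
    exact mul_le_mul_of_nonneg_left (hB x) (abs_nonneg _)
  have hd : ∀ s, HasDerivAt (ProbabilityTheory.mgf X μ) (∫ x, X x * Real.exp (s * X x) ∂μ) s :=
    fun s => ProbabilityTheory.hasDerivAt_mgf (by rw [huniv, interior_univ]; trivial)
  have hd2 : ∀ s, HasDerivAt (fun s => Real.exp (-(v * s ^ 2 / 2)) * ProbabilityTheory.mgf X μ s)
      (Real.exp (-(v * s ^ 2 / 2)) * (-(v * s)) * ProbabilityTheory.mgf X μ s +
        Real.exp (-(v * s ^ 2 / 2)) * ∫ x, X x * Real.exp (s * X x) ∂μ) s := by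
    intro s
    refine HasDerivAt.mul ?_ (hd s)
    refine HasDerivAt.exp ?_
    have := (((hasDerivAt_id s).pow 2).const_mul v).div_const 2 |>.neg
    refine this.congr_deriv ?_
    simp
    ring
  have hanti : AntitoneOn (fun s => Real.exp (-(v * s ^ 2 / 2)) * ProbabilityTheory.mgf X μ s)
      (Ici 0) := by
    refine antitoneOn_of_deriv_nonpos (convex_Ici 0)
      (fun s _ => (hd2 s).continuousAt.continuousWithinAt)
      (fun s _ => (hd2 s).differentiableAt.differentiableWithinAt) fun s hs => ?_
    rw [interior_Ici] at hs
    rw [(hd2 s).deriv]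
    have := h s (le_of_lt hs)
    have e : ProbabilityTheory.mgf X μ s = ∫ x, Real.exp (s * X x) ∂μ := rfl
    rw [e]
    nlinarith [Real.exp_pos (-(v * s ^ 2 / 2))]
  have := hanti (mem_Ici.2 le_rfl) (mem_Ici.2 ht) ht
  simp only [ProbabilityTheory.mgf_zero, ne_eq, OfNat.ofNat_ne_zero, not_false_eq_true, zero_pow,
    mul_zero, zero_div, neg_zero, Real.exp_zero, mul_one, Real.exp_neg] at this
  rwa [inv_mul_le_iff₀ (Real.exp_pos _), mul_one] at this

lemma measureReal_le_of_covariance_exp {Ω : Type*} [MeasurableSpace Ω] {μ : Measure Ω}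
    [IsProbabilityMeasure μ] {X : Ω → ℝ} (hX : AEMeasurable X μ) {v B : ℝ} (hB : ∀ x, |X x| ≤ B)
    (hv : 0 < v) (h : ∀ t : ℝ, 0 ≤ t → ∫ x, X x * Real.exp (t * X x) ∂μ ≤
      v * t * ∫ x, Real.exp (t * X x) ∂μ) {ε : ℝ} (hε : 0 ≤ ε) :
    μ.real {x | ε ≤ X x} ≤ Real.exp (-(ε ^ 2 / (2 * v))) := by
  have ht : 0 ≤ ε / v := by positivity
  have hi : Integrable (fun x => Real.exp (ε / v * X x)) μ := by
    refine Integrable.of_bound (Real.measurable_exp.comp_aemeasurable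
      (hX.const_mul _)).aestronglyMeasurable (Real.exp (ε / v * B)) (ae_of_all _ fun x => ?_)
    rw [Real.norm_eq_abs, abs_of_pos (Real.exp_pos _), Real.exp_le_exp]
    exact mul_le_mul_of_nonneg_left ((le_abs_self _).trans (hB x)) ht
  refine (ProbabilityTheory.measure_ge_le_exp_mul_mgf ε ht hi).trans ?_
  refine (mul_le_mul_of_nonneg_left (mgf_le_of_covariance_exp hX hB h ht)
    (Real.exp_pos _).le).trans_eq ?_
  rw [← Real.exp_add]
  congr 1
  field_simp
  ring

lemma abs_exp_sub_one_le (z : ℝ) : |Real.exp z - 1| ≤ |z| + z ^ 2 * Real.exp |z| := by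
  rcases le_total 0 z with h | h
  · have h1 : 0 ≤ Real.exp z - 1 := by linarith [Real.add_one_le_exp z]
    rw [abs_of_nonneg h, abs_of_nonneg h1]
    have h2 : Real.exp z * (1 - z) ≤ 1 := by
      have := mul_le_mul_of_nonneg_left (Real.one_sub_le_exp_neg z) (Real.exp_pos z).le
      rwa [← Real.exp_add, add_neg_cancel, Real.exp_zero] at this
    nlinarith
  · have h1 : Real.exp z - 1 ≤ 0 := by linarith [Real.exp_le_one_iff.2 h]
    rw [abs_of_nonpos h, abs_of_nonpos h1]
    have := Real.add_one_le_exp z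
    have : 0 ≤ z ^ 2 * Real.exp (-z) := by positivity
    linarith

lemma abs_exp_mul_sub_le {a b t B : ℝ} (ht : 0 ≤ t) (ha : |a| ≤ B) (hb : |b| ≤ B) :
    |Real.exp (t * b) - Real.exp (t * a)| ≤
      t * Real.exp (t * a) * |b - a| + t ^ 2 * Real.exp (3 * (t * B)) * (b - a) ^ 2 := by
  have e : Real.exp (t * b) - Real.exp (t * a) =
      Real.exp (t * a) * (Real.exp (t * (b - a)) - 1) := by
    rw [mul_sub, ← Real.exp_add]
    ring_nf
  have h1 := abs_exp_sub_one_le (t * (b - a))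
  have hba : |b - a| ≤ 2 * B := (abs_sub _ _).trans (by linarith)
  rw [e, abs_mul, abs_of_pos (Real.exp_pos _)]
  refine (mul_le_mul_of_nonneg_left h1 (Real.exp_pos _).le).trans ?_
  rw [abs_mul, abs_of_nonneg ht, mul_add]
  refine add_le_add (le_of_eq (by ring)) ?_
  have h2 : Real.exp (t * a) * Real.exp (t * |b - a|) ≤ Real.exp (3 * (t * B)) := by
    rw [← Real.exp_add, Real.exp_le_exp]
    have := mul_le_mul_of_nonneg_left ((le_abs_self a).trans ha) ht
    have := mul_le_mul_of_nonneg_left hba ht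
    linarith
  calc Real.exp (t * a) * ((t * (b - a)) ^ 2 * Real.exp (t * |b - a|))
      = t ^ 2 * (Real.exp (t * a) * Real.exp (t * |b - a|)) * (b - a) ^ 2 := by ring
    _ ≤ _ := by gcongr

lemma le_exp_of_two_bounds {q y : ℝ} (hy : 0 ≤ y) (h1 : y * q ≤ 1 - q)
    (h2 : q ≤ 2 * Real.exp (-y)) : q ≤ Real.exp (-(y / 3)) := by
  rcases le_total y (3 / 2) with h | h
  · have h3 := Real.one_sub_le_exp_neg (y / 3)
    have h5 : 0 < 1 + y := by linarith
    have h4 : q ≤ 1 / (1 + y) := by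
      rw [le_div_iff₀ h5]
      linarith
    refine h4.trans (le_trans ?_ h3)
    rw [div_le_iff₀ h5]
    nlinarith
  · refine h2.trans ?_
    have e : Real.exp (-(y / 3)) = Real.exp (2 * y / 3) * Real.exp (-y) := by
      rw [← Real.exp_add]
      ring_nf
    rw [e]
    refine mul_le_mul_of_nonneg_right ?_ (Real.exp_pos _).le
    linarith [Real.add_one_le_exp (2 * y / 3)]

lemma IsGradient.neg {g : Matrix (Fin N) (Fin N) ℝ → ℝ}
    {D : Matrix (Fin N) (Fin N) ℝ → Matrix (Fin N) (Fin N) ℝ} {L K l : ℝ}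
    (hg : IsGradient g D L K l) : IsGradient (fun x => -g x) (fun x => -D x) L K l := by
  refine ⟨hg.L_nonneg, hg.K_nonneg, hg.l_nonneg, hg.cont.neg, hg.contD.neg, fun x h => ?_,
    fun x h => ?_, fun x A hA => ?_⟩
  · rw [ip_neg_left, abs_neg]
    exact hg.lip x h
  · rw [ip_neg_left, ← abs_neg]
    refine (le_of_eq ?_).trans (hg.taylor x h)
    ring_nf
  · rw [ip_neg_left, abs_neg]
    exact hg.tang x A hA

lemma IsGradient.upper_tail (hN : 3 ≤ N) {g : Matrix (Fin N) (Fin N) ℝ → ℝ}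
    {D : Matrix (Fin N) (Fin N) ℝ → Matrix (Fin N) (Fin N) ℝ} {L K l : ℝ}
    (μ : Measure (SO N)) [IsProbabilityMeasure μ] [μ.IsMulLeftInvariant]
    (hg : IsGradient g D L K l) (hl : 0 < l) {ε : ℝ} (hε : 0 ≤ ε) :
    μ.real {x : SO N | ε ≤ g x.1 - ∫ y, g y.1 ∂μ} ≤
      Real.exp (-(ε ^ 2 / (2 * (24 * l ^ 2 / N)))) := by
  have hN0 : (0 : ℝ) < N := by exact_mod_cast (by omega : 0 < N)
  have hgc := hg.cont
  set c := ∫ y : SO N, g y.1 ∂μ with hc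
  have hXc : Continuous fun x : SO N => g x.1 - c := by fun_prop
  obtain ⟨B, hB⟩ := exists_abs_le_of_continuous hXc
  refine measureReal_le_of_covariance_exp hXc.measurable.aemeasurable hB (by positivity)
    (fun t ht => ?_) hε
  have := hg.covariance_le hN μ (G := fun x => Real.exp (t * (g x.1 - c)))
    (w := fun x => t * Real.exp (t * (g x.1 - c))) (K' := t ^ 2 * Real.exp (3 * (t * B)))
    (by fun_prop) (by fun_prop) (fun x => by positivity) (by positivity) (fun x y => by
      have := abs_exp_mul_sub_le ht (hB x) (hB y)
      rwa [sub_sub_sub_cancel_right] at this)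
  rw [integral_const_mul, ← mul_assoc] at this
  exact this

/-- Concentration for functions with a Lipschitz gradient. -/
theorem IsGradient.concentration (hN : 3 ≤ N) {g : Matrix (Fin N) (Fin N) ℝ → ℝ}
    {D : Matrix (Fin N) (Fin N) ℝ → Matrix (Fin N) (Fin N) ℝ} {L K l : ℝ}
    (μ : Measure (SO N)) [IsProbabilityMeasure μ] [μ.IsMulLeftInvariant]
    (hg : IsGradient g D L K l) (hl : 0 < l) {ε : ℝ} (hε : 0 < ε) :
    μ.real {x : SO N | ε ≤ |g x.1 - ∫ y, g y.1 ∂μ|} ≤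
      Real.exp (-(N * ε ^ 2 / (144 * l ^ 2))) := by
  have hN0 : (0 : ℝ) < N := by exact_mod_cast (by omega : 0 < N)
  have hgc := hg.cont
  have h1 := hg.upper_tail hN μ hl hε.le
  have h2 := hg.neg.upper_tail hN μ hl hε.le
  simp only [integral_neg] at h2
  set c := ∫ y : SO N, g y.1 ∂μ with hc
  have hXc : Continuous fun x : SO N => g x.1 - c := by fun_prop
  have hcl := continuous_clip ε
  have hcov := hg.covariance_le hN μ
    (G := fun x => clip ε (g x.1 - c) - clip ε (g x.1 - c) * |clip ε (g x.1 - c)| / (2 * ε))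
    (w := fun x => 1 - |clip ε (g x.1 - c)| / ε) (K' := 1 / ε)
    (by fun_prop) (by fun_prop)
    (fun x => sub_nonneg.2 ((div_le_one hε).2 (abs_clip_le hε.le _))) (by positivity)
    (fun x y => by
      refine (abs_parabola_sub_le hε (abs_clip_le hε.le _)).trans ?_
      have h3 := abs_clip_sub_le ε (g x.1 - c) (g y.1 - c)
      rw [sub_sub_sub_cancel_right] at h3
      have h4 := sub_nonneg.2 ((div_le_one hε).2 (abs_clip_le hε.le (g x.1 - c)))
      have h5 := sq_le_sq.2 h3
      gcongr)
  have h3 := measureReal_le_of_covariance_clip (μ := μ) hXc.measurable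
    (v := 24 * l ^ 2 / N) (by positivity) hε (integrable_SO μ (by fun_prop)) hcov
  have e : N * ε ^ 2 / (144 * l ^ 2) = ε ^ 2 / (2 * (24 * l ^ 2 / N)) / 3 := by
    field_simp
    norm_num
  rw [e]
  refine le_exp_of_two_bounds (by positivity) ?_ ?_
  · have hv : 0 < 24 * l ^ 2 / (N : ℝ) := by positivity
    rw [← div_div, div_mul_eq_mul_div, div_le_iff₀ hv, mul_comm _ (24 * l ^ 2 / (N : ℝ))]
    exact h3
  · have hsub : {x : SO N | ε ≤ |g x.1 - c|} ⊆
        {x : SO N | ε ≤ g x.1 - c} ∪ {x : SO N | ε ≤ -g x.1 - -c} := by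
      intro x hx
      rcases le_abs.1 (show ε ≤ |g x.1 - c| from hx) with h | h
      · exact Or.inl h
      · exact Or.inr (show ε ≤ -g x.1 - -c by linarith)
    refine (measureReal_mono hsub).trans ((measureReal_union_le _ _).trans ?_)
    linarith

/-! ### Smoothing Lipschitz functions -/

section Smoothing

open scoped Convolution NNReal

lemma norm_integral_smul_sub_le {E E' : Type*} [NormedAddCommGroup E] [MeasurableSpace E]
    [BorelSpace E] [NormedAddCommGroup E'] [NormedSpace ℝ E']
    (μ : Measure E) [IsFiniteMeasureOnCompacts μ] {f : E → ℝ} {L : ℝ≥0} (hf : LipschitzWith L f)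
    {ψ : E → E'} (hψ : Continuous ψ) (hψc : HasCompactSupport ψ) (x y : E) :
    ‖∫ t, f (x - t) • ψ t ∂μ - ∫ t, f (y - t) • ψ t ∂μ‖ ≤ (L * ∫ t, ‖ψ t‖ ∂μ) * ‖x - y‖ := by
  have hfc := hf.continuous
  have hi : ∀ z, Integrable (fun t => f (z - t) • ψ t) μ := fun z =>
    Continuous.integrable_of_hasCompactSupport (by fun_prop) hψc.smul_left
  rw [← integral_sub (hi x) (hi y)]
  have hn : Integrable (fun t => ‖ψ t‖) μ :=
    (hψ.integrable_of_hasCompactSupport hψc).norm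
  refine (norm_integral_le_of_norm_le (hn.const_mul (L * ‖x - y‖)) (ae_of_all _ fun t => ?_)).trans
    (le_of_eq ?_)
  · rw [← sub_smul, norm_smul]
    have := hf.norm_sub_le (x - t) (y - t)
    rw [sub_sub_sub_cancel_right] at this
    gcongr
  · rw [integral_const_mul]
    ring

/-- A Lipschitz function is uniformly close to one with Lipschitz gradient and the same Lipschitz
constant. -/
lemma exists_smooth_approx {E : Type*} [NormedAddCommGroup E] [InnerProductSpace ℝ E]
    [FiniteDimensional ℝ E] [MeasurableSpace E] [BorelSpace E] {f : E → ℝ} {L : ℝ≥0}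
    (hf : LipschitzWith L f) {δ : ℝ} (hδ : 0 < δ) :
    ∃ (g : E → ℝ) (g' : E → E →L[ℝ] ℝ) (K : ℝ), 0 ≤ K ∧ Continuous g ∧ Continuous g' ∧
      (∀ x, ‖g' x‖ ≤ L) ∧ (∀ x h, |g (x + h) - g x - g' x h| ≤ K * ‖h‖ ^ 2) ∧
      ∀ x, |g x - f x| ≤ δ := by
  have hr : 0 < δ / (L + 1) := by positivity
  let φ : ContDiffBump (0 : E) := ⟨δ / (L + 1) / 2, δ / (L + 1), by positivity, by linarith⟩
  set ρ := φ.normed volume with hρ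
  have hρs : ContDiff ℝ 1 ρ := φ.contDiff_normed
  have hρc : HasCompactSupport ρ := φ.hasCompactSupport_normed
  have hρ0 : ∀ t, 0 ≤ ρ t := φ.nonneg_normed
  have hρ1 : ∫ t, ρ t = 1 := φ.integral_normed
  have hdc : Continuous (fderiv ℝ ρ) := hρs.continuous_fderiv one_ne_zero
  have hdcs : HasCompactSupport (fderiv ℝ ρ) := hρc.fderiv ℝ
  set g : E → ℝ := fun x => ∫ t, f (x - t) • ρ t with hg
  set g' : E → E →L[ℝ] ℝ := fun x => ∫ t, f (x - t) • fderiv ℝ ρ t with hg'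
  have hderiv : ∀ x, HasFDerivAt g (g' x) x := by
    intro x
    have h := hρc.hasFDerivAt_convolution_left (μ := volume) (ContinuousLinearMap.lsmul ℝ ℝ) hρs
      hf.continuous.locallyIntegrable x
    have e1 : (ρ ⋆[ContinuousLinearMap.lsmul ℝ ℝ, volume] f) = g := by
      funext z
      simp [convolution_def, hg, mul_comm]
    have e2 : (fderiv ℝ ρ ⋆[(ContinuousLinearMap.lsmul ℝ ℝ).precompL E, volume] f) x = g' x := by
      rw [convolution_def]
      refine integral_congr_ae (ae_of_all _ fun t => ?_)
      ext v
      simp [mul_comm]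
    rwa [e1, e2] at h
  have hgl : LipschitzWith L g := by
    refine LipschitzWith.of_dist_le_mul fun x y => ?_
    rw [dist_eq_norm, dist_eq_norm]
    refine (norm_integral_smul_sub_le volume hf hρs.continuous hρc x y).trans (le_of_eq ?_)
    simp only [Real.norm_eq_abs, abs_of_nonneg (hρ0 _), hρ1, mul_one]
  set K := L * ∫ t, ‖fderiv ℝ ρ t‖ with hK
  have hK0 : 0 ≤ K := mul_nonneg L.2 (integral_nonneg fun t => norm_nonneg _)
  have hg'l : ∀ x y, ‖g' x - g' y‖ ≤ K * ‖x - y‖ := fun x y =>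
    norm_integral_smul_sub_le volume hf hdc hdcs x y
  refine ⟨g, g', K, hK0, hgl.continuous, ?_, fun x => ?_, fun x h => ?_, fun x => ?_⟩
  · have : LipschitzWith K.toNNReal g' := LipschitzWith.of_dist_le_mul fun x y => by
      rw [dist_eq_norm, dist_eq_norm, Real.coe_toNNReal _ hK0]
      exact hg'l x y
    exact this.continuous
  · rw [← (hderiv x).fderiv]
    exact norm_fderiv_le_of_lipschitz ℝ hgl
  · have := (convex_segment x (x + h)).norm_image_sub_le_of_norm_hasFDerivWithin_le'
      (f := g) (f' := g') (φ := g' x) (C := K * ‖h‖)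
      (fun z _ => (hderiv z).hasFDerivWithinAt) (fun z hz => by
        refine (hg'l z x).trans (mul_le_mul_of_nonneg_left ?_ hK0)
        obtain ⟨a, ha, rfl⟩ := (segment_eq_image' ℝ x (x + h) ▸ hz)
        rw [add_sub_cancel_left, add_sub_cancel_left, norm_smul, Real.norm_eq_abs,
          abs_of_nonneg ha.1]
        exact mul_le_of_le_one_left (norm_nonneg _) ha.2)
      (left_mem_segment ℝ x (x + h)) (right_mem_segment ℝ x (x + h))
    rw [add_sub_cancel_left, Real.norm_eq_abs] at this
    rw [pow_two, ← mul_assoc]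
    exact this
  · have hfc := hf.continuous
    have hρcont := hρs.continuous
    have e : g x - f x = ∫ t, (f (x - t) - f x) * ρ t := by
      have h1 : f x = ∫ t, f x * ρ t := by rw [integral_const_mul, hρ1, mul_one]
      have i1 : Integrable (fun t => f (x - t) * ρ t) :=
        Continuous.integrable_of_hasCompactSupport (by fun_prop) hρc.mul_left
      have i2 : Integrable (fun t => f x * ρ t) :=
        Continuous.integrable_of_hasCompactSupport (by fun_prop) hρc.mul_left
      simp only [hg, smul_eq_mul, sub_mul]
      rw [integral_sub i1 i2, ← h1]
    rw [e, ← Real.norm_eq_abs]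
    have hi : Integrable (fun t => δ * ρ t) :=
      (hρcont.integrable_of_hasCompactSupport hρc).const_mul _
    refine (norm_integral_le_of_norm_le hi (ae_of_all _ fun t => ?_)).trans (le_of_eq ?_)
    · rw [norm_mul, Real.norm_eq_abs (ρ t), abs_of_nonneg (hρ0 t)]
      by_cases ht : ρ t = 0
      · simp [ht]
      · refine mul_le_mul_of_nonneg_right ?_ (hρ0 t)
        have hts : t ∈ Metric.ball (0 : E) (δ / (L + 1)) := by
          have : t ∈ Function.support ρ := ht
          rwa [hρ, φ.support_normed_eq] at this
        have h1 := hf.norm_sub_le (x - t) x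
        rw [sub_sub_cancel_left, norm_neg] at h1
        rw [mem_ball_zero_iff] at hts
        refine h1.trans ((mul_le_mul_of_nonneg_left hts.le L.2).trans ?_)
        have h2 : (0 : ℝ) ≤ L := L.2
        change (L : ℝ) * (δ / (L + 1)) ≤ δ
        rw [← mul_div_assoc, div_le_iff₀ (by positivity)]
        nlinarith
    · rw [integral_const_mul, hρ1, mul_one]

end Smoothing

/-- A matrix as a vector in Euclidean space. -/
noncomputable def toEuc (A : Matrix (Fin N) (Fin N) ℝ) : EuclideanSpace ℝ (Fin N × Fin N) :=
  WithLp.toLp 2 fun p => A p.1 p.2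

/-- The matrix with prescribed Euclidean coordinates. -/
def ofEuc (x : EuclideanSpace ℝ (Fin N × Fin N)) : Matrix (Fin N) (Fin N) ℝ :=
  Matrix.of fun i j => x (i, j)

lemma ofEuc_toEuc (A : Matrix (Fin N) (Fin N) ℝ) : ofEuc (toEuc A) = A := rfl

lemma toEuc_add (A B : Matrix (Fin N) (Fin N) ℝ) : toEuc (A + B) = toEuc A + toEuc B := rfl

lemma toEuc_sub (A B : Matrix (Fin N) (Fin N) ℝ) : toEuc (A - B) = toEuc A - toEuc B := rfl

lemma inner_toEuc (x : EuclideanSpace ℝ (Fin N × Fin N)) (h : Matrix (Fin N) (Fin N) ℝ) :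
    inner ℝ x (toEuc h) = ip (ofEuc x) h := by
  simp [PiLp.inner_apply, ip, ofEuc, toEuc, Fintype.sum_prod_type, mul_comm]

lemma norm_toEuc (A : Matrix (Fin N) (Fin N) ℝ) : ‖toEuc A‖ = hs A := by
  rw [norm_eq_sqrt_real_inner, inner_toEuc, ofEuc_toEuc, hs]

lemma continuous_toEuc : Continuous (toEuc : Matrix (Fin N) (Fin N) ℝ → _) := by
  refine (PiLp.continuous_toLp 2 _).comp (continuous_pi fun p => ?_)
  exact continuous_id.matrix_elem p.1 p.2

lemma continuous_ofEuc : Continuous (ofEuc : EuclideanSpace ℝ (Fin N × Fin N) → _) := by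
  refine continuous_matrix fun i j => ?_
  change Continuous fun x : EuclideanSpace ℝ (Fin N × Fin N) => x (i, j)
  fun_prop

lemma exists_isGradient_approx {F : SO N → ℝ} {L : ℝ} (hL : 0 ≤ L)
    (hF : ∀ x y : SO N, |F x - F y| ≤ L * hs (x.1 - y.1)) {δ : ℝ} (hδ : 0 < δ) :
    ∃ g D K, IsGradient (N := N) g D L K L ∧ ∀ x : SO N, |g x.1 - F x| ≤ δ := by
  classical
  let S : Set (EuclideanSpace ℝ (Fin N × Fin N)) := Set.range fun x : SO N => toEuc x.1
  have hinj : ∀ x y : SO N, toEuc x.1 = toEuc y.1 → x = y := fun x y h =>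
    Subtype.ext (by rw [← ofEuc_toEuc x.1, h, ofEuc_toEuc])
  let f₀ : EuclideanSpace ℝ (Fin N × Fin N) → ℝ := fun z =>
    if h : ∃ x : SO N, toEuc x.1 = z then F h.choose else 0
  have hf₀ : ∀ x : SO N, f₀ (toEuc x.1) = F x := by
    intro x
    have h : ∃ y : SO N, toEuc y.1 = toEuc x.1 := ⟨x, rfl⟩
    simp only [f₀, dif_pos h]
    rw [hinj _ _ h.choose_spec]
  have hlip : LipschitzOnWith L.toNNReal f₀ S := by
    refine LipschitzOnWith.of_dist_le_mul ?_
    rintro _ ⟨x, rfl⟩ _ ⟨y, rfl⟩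
    simp only [hf₀]
    rw [dist_eq_norm, dist_eq_norm, Real.norm_eq_abs, ← toEuc_sub, norm_toEuc,
      Real.coe_toNNReal _ hL]
    exact hF x y
  obtain ⟨f, hf, hfS⟩ := hlip.extend_real
  obtain ⟨g, g', K, hK, hgc, hg'c, hg'L, hT, happ⟩ := exists_smooth_approx hf hδ
  rw [Real.coe_toNNReal _ hL] at hg'L
  let D : Matrix (Fin N) (Fin N) ℝ → Matrix (Fin N) (Fin N) ℝ := fun x =>
    ofEuc ((InnerProductSpace.toDual ℝ _).symm (g' (toEuc x)))
  have hD : ∀ x h, ip (D x) h = g' (toEuc x) (toEuc h) := fun x h => by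
    rw [← inner_toEuc, InnerProductSpace.toDual_symm_apply]
  have hb : ∀ x h, |ip (D x) h| ≤ L * hs h := fun x h => by
    rw [hD, ← norm_toEuc]
    exact ((g' (toEuc x)).le_opNorm _).trans
      (mul_le_mul_of_nonneg_right (hg'L _) (norm_nonneg _))
  refine ⟨fun x => g (toEuc x), D, K, ⟨hL, hK, hL, hgc.comp continuous_toEuc, ?_, hb,
    fun x h => ?_, fun x A _ => ?_⟩, fun x => ?_⟩
  · exact continuous_ofEuc.comp ((LinearIsometryEquiv.continuous _).comp
      (hg'c.comp continuous_toEuc))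
  · rw [hD, toEuc_add, ← hs_sq, ← norm_toEuc]
    exact hT _ _
  · refine (hb _ _).trans (le_of_eq ?_)
    rw [hs_orth_mul _ _ (SO_transpose_mul x)]
  · have := happ (toEuc x.1)
    rwa [← hfS ⟨x, rfl⟩, hf₀] at this

/-- Concentration for Lipschitz functions in dimension at least three. -/
theorem concentration_of_three_le (hN : 3 ≤ N) (μ : Measure (SO N)) [IsProbabilityMeasure μ]
    [μ.IsMulLeftInvariant] {F : SO N → ℝ} (hFc : Continuous F) {L : ℝ} (hL : 0 < L)
    (hF : ∀ x y : SO N, |F x - F y| ≤ L * hs (x.1 - y.1)) {ε : ℝ} (hε : 0 < ε) :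
    μ.real {x : SO N | ε ≤ |F x - ∫ y, F y ∂μ|} ≤ Real.exp (-(N * ε ^ 2 / (144 * L ^ 2))) := by
  have key : ∀ᶠ δ in nhdsWithin (0 : ℝ) (Ioi 0), μ.real {x : SO N | ε ≤ |F x - ∫ y, F y ∂μ|} ≤
      Real.exp (-(N * (ε - 2 * δ) ^ 2 / (144 * L ^ 2))) := by
    have h0 : ∀ᶠ δ in nhdsWithin (0 : ℝ) (Ioi 0), δ ∈ Ioo 0 (ε / 2) :=
      Ioo_mem_nhdsGT (by linarith)
    filter_upwards [h0] with δ hδ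
    obtain ⟨g, D, K, hg, happ⟩ := exists_isGradient_approx hL.le hF hδ.1
    refine le_trans (measureReal_mono ?_)
      (hg.concentration hN μ hL (ε := ε - 2 * δ) (by linarith [hδ.2]))
    intro x hx
    have hx' : ε ≤ |F x - ∫ y, F y ∂μ| := hx
    have hgc := hg.cont
    have h1 : |∫ y : SO N, g y.1 ∂μ - ∫ y, F y ∂μ| ≤ δ := by
      rw [← integral_sub (integrable_SO μ (by fun_prop)) (integrable_SO μ hFc)]
      exact abs_integral_le_of_forall μ happ
    have h2 := happ x
    change ε - 2 * δ ≤ |g x.1 - ∫ y : SO N, g y.1 ∂μ|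
    have h3 : F x - ∫ y, F y ∂μ = (g x.1 - ∫ y : SO N, g y.1 ∂μ) - (g x.1 - F x) +
        (∫ y : SO N, g y.1 ∂μ - ∫ y, F y ∂μ) := by ring
    rw [h3] at hx'
    have h4 := abs_add_le ((g x.1 - ∫ y : SO N, g y.1 ∂μ) - (g x.1 - F x))
        (∫ y : SO N, g y.1 ∂μ - ∫ y, F y ∂μ)
    have h5 := abs_sub (g x.1 - ∫ y : SO N, g y.1 ∂μ) (g x.1 - F x)
    linarith
  have hlim : Filter.Tendsto (fun δ : ℝ => Real.exp (-(N * (ε - 2 * δ) ^ 2 / (144 * L ^ 2))))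
      (nhdsWithin 0 (Ioi 0)) (nhds (Real.exp (-(N * (ε - 2 * 0) ^ 2 / (144 * L ^ 2))))) := by
    refine Filter.Tendsto.mono_left (Continuous.tendsto (by fun_prop) 0) nhdsWithin_le_nhds
  rw [mul_zero, sub_zero] at hlim
  exact ge_of_tendsto hlim key

/-! ### Dimension at most two -/

lemma concentration_one (μ : Measure (SO 1)) [IsProbabilityMeasure μ] {F : SO 1 → ℝ} {ε r : ℝ}
    (hε : 0 < ε) (hr : 0 ≤ r) : μ.real {x : SO 1 | ε ≤ |F x - ∫ y, F y ∂μ|} ≤ r := by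
  have h1 : ∀ x : SO 1, x = 1 := fun x => Subtype.ext (by
    have := (mem_SO.1 x.2).2
    rw [Matrix.det_fin_one] at this
    ext i j
    rw [Subsingleton.elim i 0, Subsingleton.elim j 0, this]
    rfl)
  have h2 : ∀ x, F x = F 1 := fun x => by rw [h1 x]
  have h3 : {x : SO 1 | ε ≤ |F x - ∫ y, F y ∂μ|} = ∅ := by
    refine eq_empty_of_forall_notMem fun x hx => ?_
    have hx' : ε ≤ |F x - ∫ y, F y ∂μ| := hx
    simp only [h2, integral_const, probReal_univ, one_smul, sub_self, abs_zero] at hx'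
    linarith
  rw [h3, measureReal_empty]
  exact hr

lemma rot_fin_two (a b : ℝ) : rot (0 : Fin 2) 1 a b = !![a, b; -b, a] := by
  rw [rot_eq_of_ne (by decide)]
  ext i j
  fin_cases i <;> fin_cases j <;> simp [Matrix.single]

lemma exists_eq_planeRot_fin_two (x : SO 2) :
    ∃ θ ∈ Ico 0 (2 * Real.pi), x = planeRot 0 1 θ := by
  obtain ⟨h1, h2⟩ := mem_SO.1 x.2
  have h00 := congrFun (congrFun h1 0) 0
  have h11 := congrFun (congrFun h1 1) 1
  rw [Matrix.det_fin_two] at h2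
  simp only [Matrix.mul_apply, Fin.sum_univ_two, Matrix.transpose_apply, Matrix.one_apply_eq]
    at h00 h11
  have h3 : (x.1 0 0 - x.1 1 1) ^ 2 + (x.1 0 1 + x.1 1 0) ^ 2 = 0 := by linarith
  have h4 : x.1 1 1 = x.1 0 0 := by nlinarith
  have h5 : x.1 1 0 = -x.1 0 1 := by nlinarith
  obtain ⟨θ, hθ⟩ := exists_planeRot_eq (0 : Fin 2) 1
    (show x.1 0 0 ^ 2 + x.1 0 1 ^ 2 = 1 by linarith)
  have hx : x = planeRot 0 1 θ := by
    refine Subtype.ext ?_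
    rw [hθ, rot_fin_two, Matrix.eta_fin_two x.1, h4, h5]
    rfl
  refine ⟨toIcoMod Real.two_pi_pos 0 θ, by simpa using toIcoMod_mem_Ico Real.two_pi_pos 0 θ, ?_⟩
  rw [hx]
  refine Subtype.ext ?_
  change rot 0 1 _ _ = rot 0 1 _ _
  have h6 := toIcoMod_add_toIcoDiv_zsmul Real.two_pi_pos 0 θ
  rw [zsmul_eq_mul] at h6
  conv_lhs => rw [← h6]
  rw [Real.cos_add_int_mul_two_pi, Real.sin_add_int_mul_two_pi]

lemma hs_planeRot_sub_one_fin_two_le (θ : ℝ) :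
    hs ((planeRot (0 : Fin 2) 1 θ).1 - 1) ≤ 3 / 2 * |θ| := by
  refine Real.sqrt_le_iff.2 ⟨by positivity, ?_⟩
  change ip (rot 0 1 _ _ - 1) (rot 0 1 _ _ - 1) ≤ _
  rw [rot_fin_two]
  simp only [ip, Fin.sum_univ_two, Matrix.sub_apply]
  simp
  nlinarith [Real.one_sub_sq_div_two_le_cos (x := θ), Real.sin_sq_add_cos_sq θ, sq_abs θ,
    sq_nonneg θ]

lemma one_le_mul_measureReal_ball_fin_two (μ : Measure (SO 2)) [IsProbabilityMeasure μ]
    [μ.IsMulLeftInvariant] (x₀ : SO 2) {η : ℝ} {M : ℕ} (hM : 10 < M * η) (hM0 : 0 < M) :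
    1 ≤ M * μ.real {x : SO 2 | hs (x.1 - x₀.1) < η} := by
  set B := {x : SO 2 | hs (x.1 - x₀.1) < η}
  have hM' : (0 : ℝ) < M := by exact_mod_cast hM0
  have hcover : (univ : Set (SO 2)) ⊆
      ⋃ k ∈ Finset.range M, (fun x => planeRot 0 1 (-(2 * Real.pi * k / M)) * x) ⁻¹' B := by
    intro y _
    obtain ⟨θ, ⟨h0, h1⟩, hθ⟩ := exists_eq_planeRot_fin_two (y * x₀⁻¹)
    have hy : y = planeRot 0 1 θ * x₀ := by rw [← hθ, inv_mul_cancel_right]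
    have hnn : 0 ≤ θ * M / (2 * Real.pi) := by positivity
    have hk1 := Nat.floor_le hnn
    have hk2 := Nat.lt_floor_add_one (θ * M / (2 * Real.pi))
    set k := ⌊θ * M / (2 * Real.pi)⌋₊
    rw [le_div_iff₀ Real.two_pi_pos] at hk1
    rw [div_lt_iff₀ Real.two_pi_pos] at hk2
    have hkM : k < M := by
      have h3 : (k : ℝ) * (2 * Real.pi) < M * (2 * Real.pi) := by nlinarith
      exact_mod_cast lt_of_mul_lt_mul_right h3 Real.two_pi_pos.le
    refine mem_iUnion₂.2 ⟨k, Finset.mem_range.2 hkM, ?_⟩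
    change hs ((planeRot 0 1 (-(2 * Real.pi * k / M)) * y).1 - x₀.1) < η
    rw [hy, ← mul_assoc, planeRot_mul]
    have e : (planeRot 0 1 (-(2 * Real.pi * k / M) + θ) * x₀).1 - x₀.1 =
        ((planeRot 0 1 (-(2 * Real.pi * k / M) + θ)).1 - 1) * x₀.1 := by
      rw [sub_mul, one_mul]
      rfl
    rw [e, hs_mul_orth _ _ (SO_mul_transpose x₀)]
    refine (hs_planeRot_sub_one_fin_two_le _).trans_lt ?_
    have h3 : -(2 * Real.pi * k / M) + θ = (θ * M - k * (2 * Real.pi)) / M := by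
      field_simp
      ring
    rw [h3, abs_div, abs_of_pos hM', abs_of_nonneg (by linarith), ← mul_div_assoc,
      div_lt_iff₀ hM']
    linarith [Real.pi_lt_d2]
  have h1 : μ.real univ ≤ ∑ k ∈ Finset.range M,
      μ.real ((fun x => planeRot 0 1 (-(2 * Real.pi * k / M)) * x) ⁻¹' B) :=
    (measureReal_mono hcover (measure_ne_top _ _)).trans (measureReal_biUnion_finset_le _ _)
  simp only [measureReal_def, measure_preimage_mul] at h1
  simpa [measureReal_def] using h1

lemma concentration_two (μ : Measure (SO 2)) [IsProbabilityMeasure μ]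
    [μ.IsMulLeftInvariant] {F : SO 2 → ℝ} (hFc : Continuous F) {L : ℝ} (hL : 0 < L)
    (hF : ∀ x y : SO 2, |F x - F y| ≤ L * hs (x.1 - y.1)) {ε : ℝ} (hε : 0 < ε) :
    μ.real {x : SO 2 | ε ≤ |F x - ∫ y, F y ∂μ|} ≤ Real.exp (-(2 * ε ^ 2 / (144 * L ^ 2))) := by
  have hrc : Continuous fun θ : ℝ => planeRot (0 : Fin 2) 1 θ := by
    refine Continuous.subtype_mk ?_ _
    simp only [rot]
    fun_prop
  have hex : ∃ x₀, F x₀ = ∫ y, F y ∂μ := by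
    obtain ⟨x, hx⟩ := exists_le_integral (integrable_SO μ hFc)
    obtain ⟨y, hy⟩ := exists_integral_le (integrable_SO μ hFc)
    obtain ⟨a, -, ha⟩ := exists_eq_planeRot_fin_two x
    obtain ⟨b, -, hb⟩ := exists_eq_planeRot_fin_two y
    obtain ⟨θ, hθ⟩ := mem_range_of_exists_le_of_exists_ge (hFc.comp hrc)
      ⟨a, by simpa [← ha] using hx⟩ ⟨b, by simpa [← hb] using hy⟩
    exact ⟨_, hθ⟩
  obtain ⟨x₀, hx₀⟩ := hex
  set η := ε / L with hη
  have hη0 : 0 < η := by positivity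
  have hsub : ∀ x, ε ≤ |F x - ∫ y, F y ∂μ| → η ≤ hs (x.1 - x₀.1) := fun x hx => by
    rw [hη, div_le_iff₀ hL, mul_comm]
    exact hx.trans (hx₀ ▸ hF x x₀)
  have e : 2 * ε ^ 2 / (144 * L ^ 2) = η ^ 2 / 72 := by
    rw [hη]
    field_simp
    norm_num
  rw [e]
  rcases lt_or_ge 3 η with h3 | h3
  · have : {x : SO 2 | ε ≤ |F x - ∫ y, F y ∂μ|} = ∅ := by
      refine eq_empty_of_forall_notMem fun x hx => ?_
      have h4 := (hsub x hx).trans (hs_sub_le _ _)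
      rw [hs_SO, hs_SO, Nat.cast_ofNat] at h4
      have h5 : Real.sqrt 2 ≤ 3 / 2 := Real.sqrt_le_iff.2 ⟨by norm_num, by norm_num⟩
      linarith
    rw [this, measureReal_empty]
    exact (Real.exp_pos _).le
  · set M := ⌊10 / η⌋₊ + 1
    have hM1 : 10 / η < M := by
      have := Nat.lt_floor_add_one (10 / η)
      simpa [M] using this
    have hM2 : (M : ℝ) ≤ 10 / η + 1 := by
      have := Nat.floor_le (by positivity : 0 ≤ 10 / η)
      simpa [M] using this
    rw [div_lt_iff₀ hη0] at hM1
    have hM3 : M * η ≤ 10 + η := by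
      have := mul_le_mul_of_nonneg_right hM2 hη0.le
      rwa [add_mul, div_mul_cancel₀ _ hη0.ne', one_mul] at this
    have hb := one_le_mul_measureReal_ball_fin_two μ x₀ hM1 (Nat.succ_pos _)
    set B := {x : SO 2 | hs (x.1 - x₀.1) < η}
    have hBm : MeasurableSet B :=
      (isOpen_lt (by fun_prop) continuous_const).measurableSet
    have h4 : μ.real {x : SO 2 | ε ≤ |F x - ∫ y, F y ∂μ|} ≤ 1 - μ.real B := by
      rw [← probReal_compl_eq_one_sub hBm]
      exact measureReal_mono fun x hx h => absurd (hsub x hx) (not_le.2 h)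
    have h5 : η / 13 ≤ μ.real B := by
      have h6 : (0 : ℝ) ≤ μ.real B := measureReal_nonneg
      rw [div_le_iff₀ (by norm_num)]
      nlinarith
    have h7 := Real.one_sub_le_exp_neg (η / 13)
    refine h4.trans (le_trans (by linarith) (h7.trans (Real.exp_le_exp.2 ?_)))
    nlinarith

/-- Concentration in every dimension. -/
theorem concentration (μ : Measure (SO N)) [IsProbabilityMeasure μ]
    [μ.IsMulLeftInvariant] {F : SO N → ℝ} {L : ℝ} (hL : 0 < L)
    (hF : ∀ x y : SO N, |F x - F y| ≤ L * hs (x.1 - y.1)) {ε : ℝ} (hε : 0 < ε) :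
    μ.real {x : SO N | ε ≤ |F x - ∫ y, F y ∂μ|} ≤ Real.exp (-(N * ε ^ 2 / (144 * L ^ 2))) := by
  have hFc : Continuous F := by
    refine continuous_iff_continuousAt.2 fun x => ?_
    refine tendsto_iff_norm_sub_tendsto_zero.2 ?_
    have h1 : Filter.Tendsto (fun y : SO N => L * hs (y.1 - x.1)) (nhds x) (nhds 0) := by
      have h2 : Continuous fun y : SO N => L * hs (y.1 - x.1) := by fun_prop
      have h3 := h2.tendsto x
      simpa [hs, ip] using h3
    exact squeeze_zero (fun _ => norm_nonneg _) (fun y => hF y x) h1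
  rcases N with _ | _ | _ | n
  · refine (measureReal_le_one).trans (le_of_eq ?_)
    simp
  · exact concentration_one μ hε (Real.exp_pos _).le
  · simpa using concentration_two μ hFc hL hF hε
  · exact concentration_of_three_le (by omega) μ hFc hL hF hε

/-! ### Transfer to measures on matrices -/

lemma exists_haar_SO (m : Measure (Matrix (Fin N) (Fin N) ℝ)) [IsProbabilityMeasure m]
    (h0 : m {U | ¬(U ∈ Matrix.orthogonalGroup (Fin N) ℝ ∧ U.det = 1)} = 0)
    (hinv : ∀ V : Matrix (Fin N) (Fin N) ℝ, V ∈ Matrix.orthogonalGroup (Fin N) ℝ → V.det = 1 →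
      Measure.map (fun U => V * U) m = m) :
    ∃ μ : Measure (SO N), IsProbabilityMeasure μ ∧ μ.IsMulLeftInvariant ∧
      Measure.map Subtype.val μ = m := by
  have hms : MeasurableSet {U : Matrix (Fin N) (Fin N) ℝ |
      U ∈ Matrix.specialOrthogonalGroup (Fin N) ℝ} := (isCompact_SO N).isClosed.measurableSet
  have hemb : MeasurableEmbedding (Subtype.val : SO N → Matrix (Fin N) (Fin N) ℝ) :=
    MeasurableEmbedding.subtype_coe hms
  have hae : ∀ᵐ U ∂m, U ∈ range (Subtype.val : SO N → Matrix (Fin N) (Fin N) ℝ) := by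
    rw [ae_iff]
    refine measure_mono_null ?_ h0
    intro U hU hU'
    exact hU ⟨⟨U, Matrix.mem_specialOrthogonalGroup_iff.2 hU'⟩, rfl⟩
  have hmap : Measure.map Subtype.val (Measure.comap (Subtype.val : SO N → _) m) = m := by
    rw [hemb.map_comap, Measure.restrict_eq_self_of_ae_mem hae]
  refine ⟨Measure.comap Subtype.val m, ⟨?_⟩, ⟨fun V => ?_⟩, hmap⟩
  · have := congrArg (fun ν => ν univ) hmap
    simpa [Measure.map_apply hemb.measurable MeasurableSet.univ] using this
  · have hV := Matrix.mem_specialOrthogonalGroup_iff.1 V.2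
    have hc : Continuous fun U : Matrix (Fin N) (Fin N) ℝ => V.1 * U := by fun_prop
    have hc' : Continuous fun U : SO N => V * U := by fun_prop
    refine (MeasurableEmbedding.map_injective hemb) ?_
    rw [Measure.map_map hemb.measurable hc'.measurable]
    conv_rhs => rw [hmap, ← hinv V.1 hV.1 hV.2, ← hmap]
    rw [Measure.map_map hc.measurable hemb.measurable]
    rfl

end SOConcentration

open SOConcentration

/-- Gromov–Lévy concentration on `SO(N)`: there is a universal constant `c > 0`,
independent of `N`, such that for the Haar probability measure `M_N` on `SO(N)`
(encoded as a left-invariant probability measure carried by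
`SO(N) = {U ∈ O(N) : det U = 1}`) and every function `F` which is Lipschitz with
constant `‖F‖_L` for the Euclidean (Hilbert–Schmidt) distance on matrices,
`M_N(|F(U) − ∫ F dM_N| ≥ ε) ≤ exp(−c N ‖F‖_L⁻² ε²)` for every `ε > 0`. -/
theorem gromov_concentration_SO :
    ∃ c : ℝ, 0 < c ∧
      ∀ (N : ℕ) (m : Measure (Matrix (Fin N) (Fin N) ℝ)),
        IsProbabilityMeasure m →
        m {U | ¬(U ∈ Matrix.orthogonalGroup (Fin N) ℝ ∧ U.det = 1)} = 0 →
        (∀ V : Matrix (Fin N) (Fin N) ℝ,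
          V ∈ Matrix.orthogonalGroup (Fin N) ℝ → V.det = 1 →
          Measure.map (fun U => V * U) m = m) →
        ∀ (F : Matrix (Fin N) (Fin N) ℝ → ℝ) (L : ℝ), 0 < L →
        (∀ U U' : Matrix (Fin N) (Fin N) ℝ,
          U ∈ Matrix.orthogonalGroup (Fin N) ℝ → U.det = 1 →
          U' ∈ Matrix.orthogonalGroup (Fin N) ℝ → U'.det = 1 →
          |F U - F U'| ≤ L * Real.sqrt (∑ i, ∑ j, (U i j - U' i j) ^ 2)) →
        ∀ ε > 0,
          m {U | ε ≤ |F U - ∫ W, F W ∂m|}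
            ≤ ENNReal.ofReal (Real.exp (-(c * N * ε ^ 2) / L ^ 2)) := by
  refine ⟨1 / 144, by norm_num, fun N m hm h0 hinv F L hL hF ε hε => ?_⟩
  obtain ⟨μ, hμ, hμi, rfl⟩ := exists_haar_SO m h0 hinv
  have hemb : MeasurableEmbedding (Subtype.val : SO N → Matrix (Fin N) (Fin N) ℝ) :=
    MeasurableEmbedding.subtype_coe (isCompact_SO N).isClosed.measurableSet
  rw [hemb.integral_map, hemb.map_apply]
  have hlip : ∀ x y : SO N, |F x.1 - F y.1| ≤ L * hs (x.1 - y.1) := fun x y => by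
    have hx := Matrix.mem_specialOrthogonalGroup_iff.1 x.2
    have hy := Matrix.mem_specialOrthogonalGroup_iff.1 y.2
    simpa only [hs, ip, Matrix.sub_apply, pow_two] using hF x.1 y.1 hx.1 hx.2 hy.1 hy.2
  have := concentration μ (F := fun x => F x.1) hL hlip hε
  rw [← ofReal_measureReal]
  refine ENNReal.ofReal_le_ofReal (this.trans (le_of_eq ?_))
  congr 1
  field_simp
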